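/- arXiv:1911.02643 — 5 statements merged into one kernel-verified Lean document; each statement's English description precedes it below -/
import Mathlib

section
/- Let a, b ∈ ℝ, c ≥ 0, let μ be a nonnegative measure on (0,∞), and let h : (0,∞) → (0,∞) be measurable such that for every x > 0 the integral ∫₀^∞ log((t+x)/h(t)) dμ(t) is finite, and define f(x) := a + b·x + c·log x + ∫₀^∞ log((t+x)/h(t)) dμ(t) for x > 0. Define the quantum Jensen divergence Δ_f(X,Y) := tr f((X+Y)/2) − (1/2)·tr f(X) − (1/2)·tr f(Y) for X, Y ∈ ℙ_d. Then Δ_f(X,Y) ≥ 0, Δ_f(X,Y) = Δ_f(Y,X), Δ_f(X,X) = 0, and √(Δ_f(X,Z)) ≤ √(Δ_f(X,Y)) + √(Δ_f(Y,Z)) for all X, Y, Z ∈ ℙ_d. -/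
open MeasureTheory Matrix
open scoped ComplexOrder

/-- `tr g(X)` for a Hermitian matrix `X`: the sum of `g` over the eigenvalues of `X`. -/
noncomputable def traceF {d : ℕ} (g : ℝ → ℝ) (X : Matrix (Fin d) (Fin d) ℂ) : ℝ :=
  if hX : X.IsHermitian then ∑ i, g (hX.eigenvalues i) else 0

/-- The quantum Jensen divergence `Δ_f(X,Y) = tr f((X+Y)/2) − (1/2) tr f(X) − (1/2) tr f(Y)`. -/
noncomputable def jensenDiv {d : ℕ} (f : ℝ → ℝ) (X Y : Matrix (Fin d) (Fin d) ℂ) : ℝ :=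
  traceF f ((1 / 2 : ℝ) • (X + Y)) - (1 / 2) * traceF f X - (1 / 2) * traceF f Y

lemma Matrix.PosDef.half_add {n : Type*} {X Y : Matrix n n ℂ} (hX : X.PosDef) (hY : Y.PosDef) :
    ((1 / 2 : ℝ) • (X + Y)).PosDef :=
  (hX.add hY).smul (by norm_num)

section LogDet

variable {n : Type*} [Fintype n] [DecidableEq n]

/-- The log-det Jensen divergence `log det((X+Y)/2) − (1/2) log det X − (1/2) log det Y`. -/
noncomputable def logDetDiv (X Y : Matrix n n ℂ) : ℝ :=
  Real.log ‖((1 / 2 : ℝ) • (X + Y)).det‖ - (1 / 2) * Real.log ‖X.det‖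
    - (1 / 2) * Real.log ‖Y.det‖

lemma Matrix.PosDef.log_norm_det_le {M : Matrix n n ℂ} (hM : M.PosDef) :
    Real.log ‖M.det‖ ≤ M.trace.re - Fintype.card n := by
  have hpos := hM.eigenvalues_pos
  rw [hM.1.det_eq_prod_eigenvalues, hM.1.trace_eq_sum_eigenvalues, norm_prod,
    Real.log_prod fun i _ => by simpa using (hpos i).ne', ← Finset.card_univ,
    Finset.card_eq_sum_ones, Nat.cast_sum, Complex.re_sum, ← Finset.sum_sub_distrib]
  refine Finset.sum_le_sum fun i _ => ?_
  simpa [abs_of_pos (hpos i)] using Real.log_le_sub_one_of_pos (hpos i)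

lemma Matrix.two_mul_log_norm_det_le {N : Matrix n n ℂ} (hN : IsUnit N) :
    2 * Real.log ‖N.det‖ ≤ (Nᴴ * N).trace.re - Fintype.card n := by
  have hdet : ‖N.det‖ ≠ 0 := by simpa using ((Matrix.isUnit_iff_isUnit_det N).1 hN).ne_zero
  have := (PosDef.conjTranspose_mul_self N (mulVec_injective_of_isUnit hN)).log_norm_det_le
  rw [det_mul, det_conjTranspose, norm_mul, norm_star, Real.log_mul hdet hdet] at this
  linarith

lemma Matrix.log_norm_det_one_sub_mul_le {R S : Matrix n n ℂ} (hu : IsUnit (1 - S * R)) :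
    Real.log ‖(1 - S * R).det‖ ≤ ((Rᴴ * R).trace.re + (Sᴴ * S).trace.re) / 2 := by
  have hdet : (fromBlocks 1 R S 1).det = (1 - S * R).det := det_fromBlocks_one₁₁ R S 1
  have hN : IsUnit (fromBlocks 1 R S 1) := by
    rwa [Matrix.isUnit_iff_isUnit_det, hdet, ← Matrix.isUnit_iff_isUnit_det]
  have h := two_mul_log_norm_det_le hN
  rw [hdet, fromBlocks_conjTranspose, fromBlocks_multiply] at h
  simp [Matrix.trace, Fintype.sum_sum_type, Finset.sum_add_distrib] at h
  simp only [Matrix.trace, diag_apply, Complex.re_sum]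
  linarith

lemma Matrix.PosDef.norm_det_ne_zero {X : Matrix n n ℂ} (hX : X.PosDef) : ‖X.det‖ ≠ 0 := by
  simpa using hX.det_pos.ne'

lemma trace_sq_one_sub_inv_le {X A : Matrix n n ℂ} (hX : X.PosDef)
    (hA : A = (1 / 2 : ℝ) • (X + 1)) :
    ((1 - A⁻¹)ᴴ * (1 - A⁻¹)).trace.re ≤ 2 * logDetDiv X 1 := by
  have hApd : A.PosDef := hA ▸ hX.half_add PosDef.one
  have hAi := hApd.inv
  have hX2 : X = 2 • A - 1 := by rw [hA]; module
  have h1 : A⁻¹ * A = 1 := nonsing_inv_mul A ((Matrix.isUnit_iff_isUnit_det A).1 hApd.isUnit)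
  have hM := hX.conjTranspose_mul_mul_same (mulVec_injective_of_isUnit hAi.isUnit)
  have hle := hM.log_norm_det_le
  rw [hAi.1.eq] at hle
  have hdet : Real.log ‖(A⁻¹ * X * A⁻¹).det‖ = -2 * logDetDiv X 1 := by
    rw [logDetDiv, ← hA, det_mul, det_mul, det_nonsing_inv, Ring.inverse_eq_inv', norm_mul,
      norm_mul, norm_inv,
      Real.log_mul (mul_ne_zero (inv_ne_zero hApd.norm_det_ne_zero) hX.norm_det_ne_zero)
        (inv_ne_zero hApd.norm_det_ne_zero),
      Real.log_mul (inv_ne_zero hApd.norm_det_ne_zero) hX.norm_det_ne_zero, Real.log_inv]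
    simp
    ring
  have hmul : A⁻¹ * X * A⁻¹ = 1 - (1 - A⁻¹)ᴴ * (1 - A⁻¹) := by
    rw [conjTranspose_sub, conjTranspose_one, hAi.1.eq, hX2]
    simp only [mul_sub, sub_mul, mul_one, one_mul, mul_smul_comm, smul_mul_assoc, h1]
    module
  rw [hdet, hmul, trace_sub, trace_one] at hle
  simp only [Complex.sub_re, Complex.natCast_re] at hle
  linarith

lemma logDetDiv_comm (X Y : Matrix n n ℂ) : logDetDiv X Y = logDetDiv Y X := by
  rw [logDetDiv, logDetDiv, add_comm X Y]; ring

lemma logDetDiv_le_through_one {X Y : Matrix n n ℂ} (hX : X.PosDef) (hY : Y.PosDef) {ε : ℝ}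
    (hε : 0 < ε) :
    logDetDiv X Y ≤ (1 + ε) * logDetDiv X 1 + (1 + ε⁻¹) * logDetDiv 1 Y := by
  obtain ⟨A, hA⟩ : ∃ A, A = (1 / 2 : ℝ) • (X + 1) := ⟨_, rfl⟩
  obtain ⟨B, hB⟩ : ∃ B, B = (1 / 2 : ℝ) • (Y + 1) := ⟨_, rfl⟩
  have hApd : A.PosDef := hA ▸ hX.half_add PosDef.one
  have hBpd : B.PosDef := hB ▸ hY.half_add PosDef.one
  have hXY := hX.half_add hY
  have hA1 := mul_nonsing_inv A ((Matrix.isUnit_iff_isUnit_det A).1 hApd.isUnit)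
  have hB1 := nonsing_inv_mul B ((Matrix.isUnit_iff_isUnit_det B).1 hBpd.isUnit)
  have hr : 0 < Real.sqrt ε := Real.sqrt_pos.2 hε
  set r := Real.sqrt ε
  have hrr : r * r = ε := Real.mul_self_sqrt hε.le
  have hmul : 1 - (r⁻¹ • (1 - B⁻¹)) * (r • (1 - A⁻¹)) = B⁻¹ * ((1 / 2 : ℝ) • (X + Y)) * A⁻¹ := by
    have : (1 / 2 : ℝ) • (X + Y) = A + B - 1 := by rw [hA, hB]; module
    rw [this, smul_mul_smul_comm, inv_mul_cancel₀ hr.ne', one_smul]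
    simp only [mul_sub, sub_mul, mul_add, add_mul, mul_one, one_mul, hB1, mul_assoc, hA1]
    abel
  have hu : IsUnit (1 - (r⁻¹ • (1 - B⁻¹)) * (r • (1 - A⁻¹))) := by
    rw [hmul]
    exact (hBpd.inv.isUnit.mul hXY.isUnit).mul hApd.inv.isUnit
  have hle := log_norm_det_one_sub_mul_le hu
  have hdet : Real.log ‖(B⁻¹ * ((1 / 2 : ℝ) • (X + Y)) * A⁻¹).det‖ =
      Real.log ‖((1 / 2 : ℝ) • (X + Y)).det‖ - Real.log ‖A.det‖ - Real.log ‖B.det‖ := by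
    rw [det_mul, det_mul, det_nonsing_inv, det_nonsing_inv, Ring.inverse_eq_inv', norm_mul,
      norm_mul, norm_inv, norm_inv,
      Real.log_mul (mul_ne_zero (inv_ne_zero hBpd.norm_det_ne_zero) hXY.norm_det_ne_zero)
        (inv_ne_zero hApd.norm_det_ne_zero),
      Real.log_mul (inv_ne_zero hBpd.norm_det_ne_zero) hXY.norm_det_ne_zero, Real.log_inv,
      Real.log_inv]
    ring
  rw [hmul, hdet, conjTranspose_smul, conjTranspose_smul, smul_mul_smul_comm, smul_mul_smul_comm,
    star_trivial, star_trivial, hrr, ← mul_inv, hrr, trace_smul, trace_smul, Complex.smul_re,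
    Complex.smul_re, smul_eq_mul, smul_eq_mul] at hle
  have hP := mul_le_mul_of_nonneg_left (trace_sq_one_sub_inv_le hX hA) hε.le
  have hQ := mul_le_mul_of_nonneg_left (trace_sq_one_sub_inv_le hY hB) (inv_pos.2 hε).le
  have hone : logDetDiv X Y = logDetDiv X 1 + logDetDiv Y 1
      + (Real.log ‖((1 / 2 : ℝ) • (X + Y)).det‖ - Real.log ‖A.det‖ - Real.log ‖B.det‖) := by
    simp only [logDetDiv, ← hA, ← hB, det_one, norm_one, Real.log_one]
    ring
  rw [logDetDiv_comm 1 Y]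
  linarith

lemma logDetDiv_congr {X Y S : Matrix n n ℂ} (hX : X.PosDef) (hY : Y.PosDef) (hS : IsUnit S) :
    logDetDiv (Sᴴ * X * S) (Sᴴ * Y * S) = logDetDiv X Y := by
  have hdet : ‖S.det‖ ≠ 0 := by simpa using ((Matrix.isUnit_iff_isUnit_det S).1 hS).ne_zero
  have key : ∀ W : Matrix n n ℂ, W.PosDef →
      Real.log ‖(Sᴴ * W * S).det‖ = Real.log ‖W.det‖ + 2 * Real.log ‖S.det‖ := by
    intro W hW
    rw [det_mul, det_mul, norm_mul, norm_mul, det_conjTranspose, norm_star,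
      Real.log_mul (mul_ne_zero hdet hW.norm_det_ne_zero) hdet,
      Real.log_mul hdet hW.norm_det_ne_zero]
    ring
  have hadd : (1 / 2 : ℝ) • (Sᴴ * X * S + Sᴴ * Y * S) = Sᴴ * ((1 / 2 : ℝ) • (X + Y)) * S := by
    simp only [mul_add, add_mul, mul_smul_comm, smul_mul_assoc]
  rw [logDetDiv, logDetDiv, hadd, key _ hX, key _ hY, key _ (hX.half_add hY)]
  ring

open scoped MatrixOrder in
lemma Matrix.PosDef.exists_conjTranspose_mul_mul_eq_one {Z : Matrix n n ℂ} (hZ : Z.PosDef) :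
    ∃ S : Matrix n n ℂ, IsUnit S ∧ Sᴴ * Z * S = 1 := by
  obtain ⟨T, hT⟩ := CStarAlgebra.nonneg_iff_eq_star_mul_self.mp hZ.posSemidef.nonneg
  rw [star_eq_conjTranspose] at hT
  have hTu : IsUnit T := by
    rw [Matrix.isUnit_iff_isUnit_det]
    refine isUnit_iff_ne_zero.2 fun h0 => hZ.norm_det_ne_zero ?_
    rw [hT, det_mul, h0, mul_zero, norm_zero]
  have h1 := mul_nonsing_inv T ((Matrix.isUnit_iff_isUnit_det T).1 hTu)
  refine ⟨T⁻¹, (Matrix.isUnit_nonsing_inv_iff).2 hTu, ?_⟩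
  rw [hT, mul_assoc, mul_assoc, h1, mul_one, ← conjTranspose_mul, h1, conjTranspose_one]

lemma logDetDiv_relaxed_triangle {X Y Z : Matrix n n ℂ} (hX : X.PosDef) (hY : Y.PosDef)
    (hZ : Z.PosDef) {ε : ℝ} (hε : 0 < ε) :
    logDetDiv X Z ≤ (1 + ε) * logDetDiv X Y + (1 + ε⁻¹) * logDetDiv Y Z := by
  obtain ⟨S, hS, hS1⟩ := hY.exists_conjTranspose_mul_mul_eq_one
  have hinj := mulVec_injective_of_isUnit hS
  have := logDetDiv_le_through_one (hX.conjTranspose_mul_mul_same hinj)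
    (hZ.conjTranspose_mul_mul_same hinj) hε
  rwa [← hS1, logDetDiv_congr hX hZ hS, logDetDiv_congr hX hY hS, logDetDiv_congr hY hZ hS]
    at this

end LogDet

section TraceFunction

variable {d : ℕ}

lemma traceF_eq_sum (g : ℝ → ℝ) {X : Matrix (Fin d) (Fin d) ℂ} (hX : X.IsHermitian) :
    traceF g X = ∑ i, g (hX.eigenvalues i) := dif_pos hX

lemma sum_log_add_eigenvalues {X : Matrix (Fin d) (Fin d) ℂ} (hX : X.PosDef) {t : ℝ}
    (ht : 0 ≤ t) :
    ∑ i, Real.log (t + hX.1.eigenvalues i) =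
      Real.log ‖(t • (1 : Matrix (Fin d) (Fin d) ℂ) + X).det‖ := by
  have hpos : ∀ i, 0 < t + hX.1.eigenvalues i := fun i => by
    linarith [hX.eigenvalues_pos i]
  have h := congrArg (fun z : ℂ => ‖z‖) (eval_charpoly X (-t : ℂ))
  have hneg : scalar (Fin d) (-t : ℂ) - X = -(t • (1 : Matrix (Fin d) (Fin d) ℂ) + X) := by
    ext i j
    by_cases hij : i = j <;> simp [hij]; ring
  simp only [hX.1.charpoly_eq, Polynomial.eval_prod, hneg, det_neg, norm_mul, norm_pow, norm_neg,
    norm_one, one_pow, one_mul, norm_prod] at h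
  rw [← h, Real.log_prod]
  · refine Finset.sum_congr rfl fun i _ => ?_
    have : ‖(-t - hX.1.eigenvalues i : ℂ)‖ = t + hX.1.eigenvalues i := by
      rw [← abs_of_pos (hpos i), ← Real.norm_eq_abs, ← Complex.norm_real, ← norm_neg]
      congr 1
      push_cast
      ring
    simp [this]
  · intro i _ h0
    have h0' : (-t - hX.1.eigenvalues i : ℂ) = 0 := by simpa using h0
    have : (-t - hX.1.eigenvalues i : ℝ) = 0 := by exact_mod_cast h0'
    linarith [hpos i]

lemma sum_eigenvalues_eq_re_trace {X : Matrix (Fin d) (Fin d) ℂ} (hX : X.IsHermitian) :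
    ∑ i, hX.eigenvalues i = X.trace.re := by
  rw [hX.trace_eq_sum_eigenvalues, Complex.re_sum]
  simp

end TraceFunction

lemma sqrt_le_sqrt_add_sqrt_of_forall_le {u v w : ℝ} (hv : 0 ≤ v) (hw : 0 ≤ w)
    (h : ∀ ε > (0 : ℝ), u ≤ (1 + ε) * v + (1 + ε⁻¹) * w) :
    Real.sqrt u ≤ Real.sqrt v + Real.sqrt w := by
  obtain ⟨p, hp, rfl⟩ : ∃ p, 0 ≤ p ∧ v = p ^ 2 := ⟨√v, Real.sqrt_nonneg _, (Real.sq_sqrt hv).symm⟩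
  obtain ⟨q, hq, rfl⟩ : ∃ q, 0 ≤ q ∧ w = q ^ 2 := ⟨√w, Real.sqrt_nonneg _, (Real.sq_sqrt hw).symm⟩
  rw [Real.sqrt_sq hp, Real.sqrt_sq hq]
  refine le_of_forall_pos_le_add fun η hη => ?_
  rw [Real.sqrt_le_left (by positivity)]
  refine (h ((q + η / 2) / (p + η / 2)) (by positivity)).trans ?_
  have h1 : (q + η / 2) / (p + η / 2) * p ^ 2 ≤ (q + η / 2) * (p + η / 2) := by
    rw [div_mul_eq_mul_div, div_le_iff₀ (by positivity), mul_assoc]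
    gcongr
    nlinarith
  have h2 : (p + η / 2) / (q + η / 2) * q ^ 2 ≤ (p + η / 2) * (q + η / 2) := by
    rw [div_mul_eq_mul_div, div_le_iff₀ (by positivity), mul_assoc]
    gcongr
    nlinarith
  rw [inv_div]
  nlinarith [mul_nonneg hp hη.le, mul_nonneg hq hη.le]

section JensenDivergence

variable {d : ℕ}

lemma jensenDiv_comm (f : ℝ → ℝ) (X Y : Matrix (Fin d) (Fin d) ℂ) :
    jensenDiv f X Y = jensenDiv f Y X := by
  rw [jensenDiv, jensenDiv, add_comm X Y]; ring

lemma jensenDiv_self (f : ℝ → ℝ) (X : Matrix (Fin d) (Fin d) ℂ) : jensenDiv f X X = 0 := by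
  have : (1 / 2 : ℝ) • (X + X) = X := by module
  rw [jensenDiv, this]; ring

variable {a b c : ℝ} {μ : Measure ℝ} {h f : ℝ → ℝ}

lemma traceF_eq_integral
    (hpos : ∀ t ∈ Set.Ioi (0 : ℝ), 0 < h t)
    (hint : ∀ x > (0 : ℝ), IntegrableOn (fun t => Real.log ((t + x) / h t)) (Set.Ioi 0) μ)
    (hf : ∀ x > (0 : ℝ), f x = a + b * x + c * Real.log x
        + ∫ t in Set.Ioi (0 : ℝ), Real.log ((t + x) / h t) ∂μ)
    {X : Matrix (Fin d) (Fin d) ℂ} (hX : X.PosDef) :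
    IntegrableOn (fun t => Real.log ‖(t • (1 : Matrix (Fin d) (Fin d) ℂ) + X).det‖
        - d * Real.log (h t)) (Set.Ioi 0) μ ∧
      traceF f X = d * a + b * X.trace.re + c * Real.log ‖X.det‖
        + ∫ t in Set.Ioi (0 : ℝ), (Real.log ‖(t • (1 : Matrix (Fin d) (Fin d) ℂ) + X).det‖
          - d * Real.log (h t)) ∂μ := by
  have hev := hX.eigenvalues_pos
  have hsum : Set.EqOn (fun t => ∑ i, Real.log ((t + hX.1.eigenvalues i) / h t))
      (fun t => Real.log ‖(t • (1 : Matrix (Fin d) (Fin d) ℂ) + X).det‖ - d * Real.log (h t))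
      (Set.Ioi 0) := by
    intro t ht
    have ht0 : 0 < t := ht
    simp only
    rw [← sum_log_add_eigenvalues hX ht0.le, Finset.sum_congr rfl fun i _ =>
      Real.log_div (add_pos ht0 (hev i)).ne' (hpos t ht).ne']
    simp
  have hI : ∀ i, IntegrableOn (fun t => Real.log ((t + hX.1.eigenvalues i) / h t))
    (Set.Ioi 0) μ := fun i => hint _ (hev i)
  refine ⟨IntegrableOn.congr_fun (integrable_finsetSum _ fun i _ => hI i) hsum measurableSet_Ioi, ?_⟩
  have h0 := sum_log_add_eigenvalues hX le_rfl
  simp only [zero_add, zero_smul] at h0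
  rw [← setIntegral_congr_fun measurableSet_Ioi hsum, integral_finsetSum _ fun i _ => hI i,
    traceF_eq_sum f hX.1, Finset.sum_congr rfl fun i _ => hf _ (hev i), ← h0,
    ← sum_eigenvalues_eq_re_trace hX.1]
  simp [Finset.sum_add_distrib, Finset.mul_sum]

lemma jensenDiv_eq_integral
    (hpos : ∀ t ∈ Set.Ioi (0 : ℝ), 0 < h t)
    (hint : ∀ x > (0 : ℝ), IntegrableOn (fun t => Real.log ((t + x) / h t)) (Set.Ioi 0) μ)
    (hf : ∀ x > (0 : ℝ), f x = a + b * x + c * Real.log x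
        + ∫ t in Set.Ioi (0 : ℝ), Real.log ((t + x) / h t) ∂μ)
    {X Y : Matrix (Fin d) (Fin d) ℂ} (hX : X.PosDef) (hY : Y.PosDef) :
    IntegrableOn (fun t : ℝ => logDetDiv (t • 1 + X) (t • 1 + Y)) (Set.Ioi 0) μ ∧
      jensenDiv f X Y = c * logDetDiv X Y
        + ∫ t in Set.Ioi (0 : ℝ), logDetDiv (t • 1 + X) (t • 1 + Y) ∂μ := by
  obtain ⟨iX, eX⟩ := traceF_eq_integral hpos hint hf hX
  obtain ⟨iY, eY⟩ := traceF_eq_integral hpos hint hf hY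
  obtain ⟨iM, eM⟩ := traceF_eq_integral hpos hint hf (hX.half_add hY)
  have hfun : (fun t : ℝ => logDetDiv (t • 1 + X) (t • 1 + Y)) = fun t =>
      (Real.log ‖(t • 1 + (1 / 2 : ℝ) • (X + Y)).det‖ - d * Real.log (h t))
      - (1 / 2) * (Real.log ‖(t • 1 + X).det‖ - d * Real.log (h t))
      - (1 / 2) * (Real.log ‖(t • 1 + Y).det‖ - d * Real.log (h t)) := by
    funext t
    have : (1 / 2 : ℝ) • (t • 1 + X + (t • 1 + Y)) = t • 1 + (1 / 2 : ℝ) • (X + Y) := by module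
    rw [logDetDiv, this]
    ring
  have iX' := iX.const_mul (1 / 2)
  have iY' := iY.const_mul (1 / 2)
  rw [hfun]
  refine ⟨(iM.sub iX').sub iY', ?_⟩
  rw [integral_sub (by exact iM.sub iX') iY', integral_sub iM iX', integral_const_mul, integral_const_mul,
    jensenDiv, eX, eY, eM, logDetDiv, trace_smul, trace_add, Complex.smul_re, Complex.add_re,
    smul_eq_mul]
  ring

lemma jensenDiv_relaxed_triangle (hc : 0 ≤ c)
    (hpos : ∀ t ∈ Set.Ioi (0 : ℝ), 0 < h t)
    (hint : ∀ x > (0 : ℝ), IntegrableOn (fun t => Real.log ((t + x) / h t)) (Set.Ioi 0) μ)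
    (hf : ∀ x > (0 : ℝ), f x = a + b * x + c * Real.log x
        + ∫ t in Set.Ioi (0 : ℝ), Real.log ((t + x) / h t) ∂μ)
    {X Y Z : Matrix (Fin d) (Fin d) ℂ} (hX : X.PosDef) (hY : Y.PosDef) (hZ : Z.PosDef) {ε : ℝ}
    (hε : 0 < ε) :
    jensenDiv f X Z ≤ (1 + ε) * jensenDiv f X Y + (1 + ε⁻¹) * jensenDiv f Y Z := by
  obtain ⟨iXZ, eXZ⟩ := jensenDiv_eq_integral hpos hint hf hX hZ
  obtain ⟨iXY, eXY⟩ := jensenDiv_eq_integral hpos hint hf hX hY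
  obtain ⟨iYZ, eYZ⟩ := jensenDiv_eq_integral hpos hint hf hY hZ
  have hshift : ∀ {W : Matrix (Fin d) (Fin d) ℂ}, W.PosDef → ∀ t ∈ Set.Ioi (0 : ℝ),
      (t • (1 : Matrix (Fin d) (Fin d) ℂ) + W).PosDef := fun hW t ht =>
    (PosDef.one.smul ht).add hW
  have hI := setIntegral_mono_on iXZ ((iXY.const_mul (1 + ε)).add (iYZ.const_mul (1 + ε⁻¹)))
    measurableSet_Ioi fun t ht =>
      logDetDiv_relaxed_triangle (hshift hX t ht) (hshift hY t ht) (hshift hZ t ht) hε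
  simp only [Pi.add_apply] at hI
  rw [integral_add (iXY.const_mul _) (iYZ.const_mul _), integral_const_mul, integral_const_mul]
    at hI
  have hL := mul_le_mul_of_nonneg_left (logDetDiv_relaxed_triangle hX hY hZ hε) hc
  rw [eXZ, eXY, eYZ]
  linarith

end JensenDivergence

/-- **Theorem 1**: if `f(x) = a + b·x + c·log x + ∫₀^∞ log((t+x)/h(t)) dμ(t)` with `c ≥ 0`,
then the square root of the quantum Jensen divergence `Δ_f` is a distance on `ℙ_d`. -/
theorem jensenDiv_sqrt_metric {d : ℕ} (a b c : ℝ) (hc : 0 ≤ c) (μ : Measure ℝ)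
    (h : ℝ → ℝ) (hmeas : Measurable fun t : Set.Ioi (0:ℝ) => h t)
    (hpos : ∀ t ∈ Set.Ioi (0:ℝ), 0 < h t)
    (hint : ∀ x > (0:ℝ),
      IntegrableOn (fun t => Real.log ((t + x) / h t)) (Set.Ioi 0) μ)
    (f : ℝ → ℝ)
    (hf : ∀ x > (0:ℝ), f x = a + b * x + c * Real.log x
        + ∫ t in Set.Ioi (0:ℝ), Real.log ((t + x) / h t) ∂μ) :
    ∀ X Y Z : Matrix (Fin d) (Fin d) ℂ, X.PosDef → Y.PosDef → Z.PosDef →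
      0 ≤ jensenDiv f X Y ∧
      jensenDiv f X Y = jensenDiv f Y X ∧
      jensenDiv f X X = 0 ∧
      Real.sqrt (jensenDiv f X Z) ≤
        Real.sqrt (jensenDiv f X Y) + Real.sqrt (jensenDiv f Y Z) := by
  intro X Y Z hX hY hZ
  have hnonneg : ∀ {V W : Matrix (Fin d) (Fin d) ℂ}, V.PosDef → W.PosDef →
      0 ≤ jensenDiv f V W := by
    intro V W hV hW
    have := jensenDiv_relaxed_triangle hc hpos hint hf hV hW hV one_pos
    rw [jensenDiv_self, jensenDiv_comm f W V] at this
    norm_num at this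
    linarith
  exact ⟨hnonneg hX hY, jensenDiv_comm f X Y, jensenDiv_self f X,
    sqrt_le_sqrt_add_sqrt_of_forall_le (hnonneg hX hY) (hnonneg hY hZ) fun ε hε =>
      jensenDiv_relaxed_triangle hc hpos hint hf hX hY hZ hε⟩
end

section
/- The square root of the S-divergence, δ_S(X,Y) := (log det((X+Y)/2) − (1/2) log det X − (1/2) log det Y)^{1/2}, is a metric on ℙ_d: δ_S²(X,Y) ≥ 0 with equality iff X = Y, δ_S(X,Y) = δ_S(Y,X), and δ_S(X,Z) ≤ δ_S(X,Y) + δ_S(Y,Z) for all X, Y, Z ∈ ℙ_d. -/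
open Matrix
open scoped ComplexOrder

/-- The S-divergence `δ_S²(X,Y) = log det((X+Y)/2) − (1/2) log det X − (1/2) log det Y`
(determinants of Hermitian positive definite matrices are positive reals, so we take
the real part of the complex determinant). -/
noncomputable def deltaS2 {d : ℕ} (X Y : Matrix (Fin d) (Fin d) ℂ) : ℝ :=
  Real.log (((1 / 2 : ℝ) • (X + Y)).det.re)
    - (1 / 2) * Real.log (X.det.re) - (1 / 2) * Real.log (Y.det.re)

namespace Real

theorem log_cosh_nonneg (u : ℝ) : 0 ≤ log (cosh u) := log_nonneg (one_le_cosh u)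

theorem hasDerivAt_log_cosh (u : ℝ) : HasDerivAt (fun x => log (cosh x)) (sinh u / cosh u) u :=
  (hasDerivAt_cosh u).log (cosh_pos u).ne'

theorem mul_sinh_div_cosh_le_two_mul_log_cosh {u : ℝ} (hu : 0 ≤ u) :
    u * (sinh u / cosh u) ≤ 2 * log (cosh u) := by
  have hd (x : ℝ) : HasDerivAt (fun x => 2 * log (cosh x) - x * (sinh x / cosh x))
      (2 * (sinh x / cosh x) - (1 * (sinh x / cosh x) +
        x * ((cosh x * cosh x - sinh x * sinh x) / cosh x ^ 2))) x :=
    ((hasDerivAt_log_cosh x).const_mul 2).sub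
      ((hasDerivAt_id x).mul ((hasDerivAt_sinh x).div (hasDerivAt_cosh x) (cosh_pos x).ne'))
  have hmono : MonotoneOn (fun x => 2 * log (cosh x) - x * (sinh x / cosh x)) (Set.Ici 0) := by
    refine monotoneOn_of_deriv_nonneg (convex_Ici 0)
      (fun x _ => (hd x).continuousAt.continuousWithinAt)
      (fun x _ => (hd x).differentiableAt.differentiableWithinAt) fun x hx => ?_
    rw [interior_Ici, Set.mem_Ioi] at hx
    have hc := cosh_pos x
    have hxs : x ≤ sinh x * cosh x := by
      have := self_le_sinh_iff.2 hx.le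
      nlinarith [one_le_cosh x]
    have hderiv : 2 * (sinh x / cosh x) - (1 * (sinh x / cosh x) +
        x * ((cosh x * cosh x - sinh x * sinh x) / cosh x ^ 2)) =
        (sinh x * cosh x - x) / cosh x ^ 2 := by
      have h := cosh_sq_sub_sinh_sq x
      rw [show cosh x * cosh x - sinh x * sinh x = 1 by rw [← h]; ring]
      field_simp
      ring
    rw [(hd x).deriv, hderiv]
    exact div_nonneg (sub_nonneg.2 hxs) (by positivity)
  have := hmono Set.self_mem_Ici hu hu
  simp only [cosh_zero, log_one, zero_mul] at this
  linarith

theorem antitoneOn_log_cosh_div_sq :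
    AntitoneOn (fun u => log (cosh u) / u ^ 2) (Set.Ioi 0) := by
  have hd {x : ℝ} (hx : 0 < x) : HasDerivAt (fun u => log (cosh u) / u ^ 2)
      ((sinh x / cosh x * x ^ 2 - log (cosh x) * (2 * x)) / (x ^ 2) ^ 2) x := by
    refine ((hasDerivAt_log_cosh x).fun_div (hasDerivAt_pow 2 x) (by positivity)).congr_deriv ?_
    simp
  refine antitoneOn_of_deriv_nonpos (convex_Ioi 0)
    (fun x hx => (hd hx).continuousAt.continuousWithinAt)
    (fun x hx => (hd (interior_subset hx)).differentiableAt.differentiableWithinAt) fun x hx => ?_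
  rw [interior_Ioi] at hx
  have hx' : 0 < x := hx
  rw [(hd hx').deriv]
  refine div_nonpos_of_nonpos_of_nonneg ?_ (by positivity)
  have := mul_sinh_div_cosh_le_two_mul_log_cosh hx'.le
  nlinarith

theorem mul_sqrt_log_cosh_le {u v : ℝ} (hu : 0 < u) (huv : u ≤ v) :
    u * √(log (cosh v)) ≤ v * √(log (cosh u)) := by
  have hv := hu.trans_le huv
  have h := sqrt_le_sqrt (antitoneOn_log_cosh_div_sq hu hv huv)
  rw [sqrt_div (log_cosh_nonneg _), sqrt_div (log_cosh_nonneg _), sqrt_sq hu.le, sqrt_sq hv.le,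
    div_le_div_iff₀ hv hu] at h
  linarith

theorem sqrt_log_cosh_add_le (u v : ℝ) :
    √(log (cosh (u + v))) ≤ √(log (cosh u)) + √(log (cosh v)) := by
  have hmono : √(log (cosh (u + v))) ≤ √(log (cosh (|u| + |v|))) := by
    refine sqrt_le_sqrt (log_le_log (cosh_pos _) (cosh_le_cosh.2 ?_))
    rw [abs_of_nonneg (by positivity : 0 ≤ |u| + |v|)]
    exact abs_add_le u v
  refine hmono.trans ?_
  rw [← cosh_abs u, ← cosh_abs v]
  rcases (abs_nonneg u).eq_or_lt with hu | hu
  · simp [← hu]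
  rcases (abs_nonneg v).eq_or_lt with hv | hv
  · simp [← hv]
  have h₁ := mul_sqrt_log_cosh_le hu (le_add_of_nonneg_right hv.le : |u| ≤ |u| + |v|)
  have h₂ := mul_sqrt_log_cosh_le hv (le_add_of_nonneg_left hu.le : |v| ≤ |u| + |v|)
  refine le_of_mul_le_mul_left ?_ (add_pos hu hv)
  linarith

theorem sqrt_sum_mul_le_add {ι : Type*} (s : Finset ι) (w a b c : ι → ℝ) (hw : ∀ i, 0 ≤ w i)
    (ha : ∀ i, 0 ≤ a i) (hb : ∀ i, 0 ≤ b i) (h : ∀ i, √(c i) ≤ √(a i) + √(b i)) :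
    √(∑ i ∈ s, w i * c i) ≤ √(∑ i ∈ s, w i * a i) + √(∑ i ∈ s, w i * b i) := by
  have hA : 0 ≤ ∑ i ∈ s, w i * a i := Finset.sum_nonneg fun i _ => mul_nonneg (hw i) (ha i)
  have hB : 0 ≤ ∑ i ∈ s, w i * b i := Finset.sum_nonneg fun i _ => mul_nonneg (hw i) (hb i)
  have hcs : ∑ i ∈ s, √(w i * a i) * √(w i * b i) ≤
      √(∑ i ∈ s, w i * a i) * √(∑ i ∈ s, w i * b i) :=
    sum_sqrt_mul_sqrt_le s (fun i => mul_nonneg (hw i) (ha i)) fun i => mul_nonneg (hw i) (hb i)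
  have hterm (i : ι) : w i * c i ≤
      w i * a i + w i * b i + 2 * (√(w i * a i) * √(w i * b i)) := by
    have hc : c i ≤ (√(a i) + √(b i)) ^ 2 := (sqrt_le_left (by positivity)).1 (h i)
    rw [sqrt_mul (hw i), sqrt_mul (hw i)]
    nlinarith [mul_le_mul_of_nonneg_left hc (hw i), sq_sqrt (ha i), sq_sqrt (hb i),
      mul_self_sqrt (hw i)]
  rw [sqrt_le_left (by positivity)]
  calc ∑ i ∈ s, w i * c i
      ≤ ∑ i ∈ s, (w i * a i + w i * b i + 2 * (√(w i * a i) * √(w i * b i))) :=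
        Finset.sum_le_sum fun i _ => hterm i
    _ = ∑ i ∈ s, w i * a i + ∑ i ∈ s, w i * b i + 2 * ∑ i ∈ s, √(w i * a i) * √(w i * b i) := by
        simp only [Finset.sum_add_distrib, Finset.mul_sum]
    _ ≤ (√(∑ i ∈ s, w i * a i) + √(∑ i ∈ s, w i * b i)) ^ 2 := by
        nlinarith [sq_sqrt hA, sq_sqrt hB]

/-- The S-divergence of positive reals is a function of the logarithmic distance. -/
theorem log_add_div_two_sub_eq_log_cosh {x y : ℝ} (hx : 0 < x) (hy : 0 < y) :
    log ((x + y) / 2) - 1 / 2 * log x - 1 / 2 * log y = log (cosh ((log x - log y) / 2)) := by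
  have hsum : (x + y) / 2 = exp ((log x + log y) / 2) * cosh ((log x - log y) / 2) := by
    rw [cosh_eq, mul_div_assoc', mul_add, ← exp_add, ← exp_add]
    ring_nf
    rw [exp_log hx, exp_log hy]
  rw [hsum, log_mul (exp_ne_zero _) (cosh_pos _).ne', log_exp]
  ring

end Real

namespace Matrix

variable {n : Type*} [Fintype n] [DecidableEq n]

theorem sum_norm_sq_row_of_mem_unitaryGroup {M : Matrix n n ℂ} (hM : M ∈ unitaryGroup n ℂ)
    (k : n) : ∑ i, ‖M k i‖ ^ 2 = 1 := by
  have h := congrFun (congrFun (mem_unitaryGroup_iff.1 hM) k) k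
  simp only [mul_apply, star_apply, RCLike.star_def, Complex.mul_conj', one_apply_eq] at h
  exact_mod_cast h

theorem sum_norm_sq_col_of_mem_unitaryGroup {M : Matrix n n ℂ} (hM : M ∈ unitaryGroup n ℂ)
    (i : n) : ∑ k, ‖M k i‖ ^ 2 = 1 := by
  have h := congrFun (congrFun (mem_unitaryGroup_iff'.1 hM) i) i
  simp only [mul_apply, star_apply, RCLike.star_def, Complex.conj_mul', one_apply_eq] at h
  exact_mod_cast h

theorem PosDef.exists_unitary_diagonal {A : Matrix n n ℂ} (hA : A.PosDef) :
    ∃ U ∈ unitaryGroup n ℂ, ∃ a : n → ℝ, (∀ i, 0 < a i) ∧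
      A = U * diagonal (fun i => (a i : ℂ)) * star U := by
  refine ⟨hA.isHermitian.eigenvectorUnitary, Subtype.prop _, hA.isHermitian.eigenvalues,
    hA.eigenvalues_pos, ?_⟩
  conv_lhs => rw [hA.isHermitian.spectral_theorem, Unitary.conjStarAlgAut_apply]
  rfl

theorem PosDef.det_re_pos {A : Matrix n n ℂ} (hA : A.PosDef) : 0 < A.det.re :=
  (Complex.pos_iff.1 hA.det_pos).1

theorem det_unitary_conj {U : Matrix n n ℂ} (hU : U ∈ unitaryGroup n ℂ) (D : Matrix n n ℂ) :
    (U * D * star U).det = D.det := by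
  rw [det_mul_comm, ← mul_assoc, mem_unitaryGroup_iff'.1 hU, one_mul]

theorem log_det_unitary_conj_diagonal {U : Matrix n n ℂ} (hU : U ∈ unitaryGroup n ℂ)
    {a : n → ℝ} (ha : ∀ i, 0 < a i) :
    Real.log (U * diagonal (fun i => (a i : ℂ)) * star U).det.re = ∑ i, Real.log (a i) := by
  rw [det_unitary_conj hU, det_diagonal, ← Complex.ofReal_prod, Complex.ofReal_re,
    Real.log_prod fun i _ => (ha i).ne']

theorem mul_diagonal_mul_star_apply_self (M : Matrix n n ℂ) (a : n → ℝ) (k : n) :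
    (M * diagonal (fun i => (a i : ℂ)) * star M) k k = ((∑ i, ‖M k i‖ ^ 2 * a i : ℝ) : ℂ) := by
  rw [mul_apply]
  simp only [mul_diagonal, star_apply, RCLike.star_def]
  push_cast
  refine Finset.sum_congr rfl fun i _ => ?_
  rw [← Complex.mul_conj']
  ring

/-- The log-determinant of a midpoint dominates an average of logarithms of midpoints of
eigenvalues, with product weights coming from unitary matrices. -/
theorem exists_unitary_log_det_midpoint_ge {U V : Matrix n n ℂ} (hU : U ∈ unitaryGroup n ℂ)
    (hV : V ∈ unitaryGroup n ℂ) {y z : n → ℝ} (hy : ∀ i, 0 < y i) (hz : ∀ i, 0 < z i)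
    (hC : ((1 / 2 : ℝ) • (U * diagonal (fun i => (y i : ℂ)) * star U +
      V * diagonal (fun i => (z i : ℂ)) * star V)).PosDef) :
    ∃ M ∈ unitaryGroup n ℂ, ∃ N ∈ unitaryGroup n ℂ,
      ∑ p : n × n × n, ‖M p.1 p.2.1‖ ^ 2 * ‖N p.1 p.2.2‖ ^ 2 *
        Real.log ((y p.2.1 + z p.2.2) / 2) ≤
      Real.log ((1 / 2 : ℝ) • (U * diagonal (fun i => (y i : ℂ)) * star U +
        V * diagonal (fun i => (z i : ℂ)) * star V)).det.re := by
  obtain ⟨W, hW, c, hc, hCW⟩ := hC.exists_unitary_diagonal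
  have hM : star W * U ∈ unitaryGroup n ℂ := mul_mem (Unitary.star_mem hW) hU
  have hN : star W * V ∈ unitaryGroup n ℂ := mul_mem (Unitary.star_mem hW) hV
  refine ⟨star W * U, hM, star W * V, hN, ?_⟩
  set M := star W * U with hMdef
  set N := star W * V with hNdef
  have hck (k : n) : c k = ∑ q : n × n, (‖M k q.1‖ ^ 2 * ‖N k q.2‖ ^ 2) *
      ((y q.1 + z q.2) / 2) := by
    have hdiag : diagonal (fun i => (c i : ℂ)) =
        (1 / 2 : ℝ) • (M * diagonal (fun i => (y i : ℂ)) * star M +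
          N * diagonal (fun i => (z i : ℂ)) * star N) := by
      have hWW := mem_unitaryGroup_iff'.1 hW
      have h : star W * (W * diagonal (fun i => (c i : ℂ)) * star W) * W =
          diagonal (fun i => (c i : ℂ)) := by
        rw [show star W * (W * diagonal (fun i => (c i : ℂ)) * star W) * W =
          (star W * W) * diagonal (fun i => (c i : ℂ)) * (star W * W) by
            simp only [mul_assoc], hWW, one_mul, mul_one]
      rw [← h, ← hCW, hMdef, hNdef]
      simp only [mul_smul_comm, smul_mul_assoc, mul_add, add_mul, star_mul, star_star, mul_assoc]
    have h := congrFun (congrFun hdiag k) k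
    rw [smul_apply, add_apply, mul_diagonal_mul_star_apply_self,
      mul_diagonal_mul_star_apply_self, diagonal_apply_eq, Complex.real_smul] at h
    have h' : c k = 1 / 2 * (∑ i, ‖M k i‖ ^ 2 * y i + ∑ i, ‖N k i‖ ^ 2 * z i) := by
      exact_mod_cast h
    have e₁ : ∑ q : n × n, (‖M k q.1‖ ^ 2 * ‖N k q.2‖ ^ 2) * y q.1 = ∑ i, ‖M k i‖ ^ 2 * y i := by
      rw [Fintype.sum_prod_type]
      refine Finset.sum_congr rfl fun i _ => ?_
      simp only [← Finset.sum_mul, ← Finset.mul_sum, sum_norm_sq_row_of_mem_unitaryGroup hN,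
        mul_one]
    have e₂ : ∑ q : n × n, (‖M k q.1‖ ^ 2 * ‖N k q.2‖ ^ 2) * z q.2 = ∑ i, ‖N k i‖ ^ 2 * z i := by
      rw [Fintype.sum_prod_type_right]
      refine Finset.sum_congr rfl fun i _ => ?_
      simp only [← Finset.sum_mul, sum_norm_sq_row_of_mem_unitaryGroup hM, one_mul]
    rw [h', ← e₁, ← e₂, ← Finset.sum_add_distrib, Finset.mul_sum]
    exact Finset.sum_congr rfl fun q _ => by ring
  have hw (k : n) : ∑ q : n × n, ‖M k q.1‖ ^ 2 * ‖N k q.2‖ ^ 2 = 1 := by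
    simp only [Fintype.sum_prod_type, ← Finset.mul_sum, sum_norm_sq_row_of_mem_unitaryGroup hN,
      mul_one, sum_norm_sq_row_of_mem_unitaryGroup hM]
  rw [hCW, log_det_unitary_conj_diagonal hW hc, Fintype.sum_prod_type]
  refine Finset.sum_le_sum fun k _ => ?_
  rw [hck k]
  simpa only [smul_eq_mul] using strictConcaveOn_log_Ioi.concaveOn.le_map_sum
    (t := Finset.univ) (w := fun q : n × n => ‖M k q.1‖ ^ 2 * ‖N k q.2‖ ^ 2)
    (p := fun q : n × n => (y q.1 + z q.2) / 2) (fun q _ => by positivity) (hw k)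
    fun q _ => half_pos (add_pos (hy q.1) (hz q.2))

theorem sum_unitary_weights_fst {M N : Matrix n n ℂ} (hM : M ∈ unitaryGroup n ℂ)
    (hN : N ∈ unitaryGroup n ℂ) (f : n → ℝ) :
    ∑ p : n × n × n, ‖M p.1 p.2.1‖ ^ 2 * ‖N p.1 p.2.2‖ ^ 2 * f p.2.1 = ∑ i, f i := by
  simp only [Fintype.sum_prod_type]
  rw [Finset.sum_comm]
  refine Finset.sum_congr rfl fun i _ => ?_
  simp only [← Finset.sum_mul, ← Finset.mul_sum, sum_norm_sq_row_of_mem_unitaryGroup hN, mul_one,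
    sum_norm_sq_col_of_mem_unitaryGroup hM, one_mul]

theorem sum_unitary_weights_snd {M N : Matrix n n ℂ} (hM : M ∈ unitaryGroup n ℂ)
    (hN : N ∈ unitaryGroup n ℂ) (f : n → ℝ) :
    ∑ p : n × n × n, ‖M p.1 p.2.1‖ ^ 2 * ‖N p.1 p.2.2‖ ^ 2 * f p.2.2 = ∑ j, f j := by
  simp only [Fintype.sum_prod_type]
  simp_rw [Finset.sum_comm (s := (Finset.univ : Finset n)) (t := (Finset.univ : Finset n))
    (f := fun i j => ‖M _ i‖ ^ 2 * ‖N _ j‖ ^ 2 * f j)]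
  rw [Finset.sum_comm]
  refine Finset.sum_congr rfl fun j _ => ?_
  simp only [← Finset.sum_mul, sum_norm_sq_row_of_mem_unitaryGroup hM, one_mul,
    sum_norm_sq_col_of_mem_unitaryGroup hN]

/-- A positive definite matrix is congruent to the identity. -/
theorem PosDef.exists_conj_eq_one {A : Matrix n n ℂ} (hA : A.PosDef) :
    ∃ S : Matrix n n ℂ, IsUnit S ∧ star S * A * S = 1 := by
  obtain ⟨U, hU, a, ha, rfl⟩ := hA.exists_unitary_diagonal
  have hUU := mem_unitaryGroup_iff'.1 hU
  set D : Matrix n n ℂ := diagonal fun i => (a i : ℂ)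
  set R : Matrix n n ℂ := diagonal fun i => (((√(a i))⁻¹ : ℝ) : ℂ) with hR
  have hRs : star R = R := by
    rw [hR, star_eq_conjTranspose, diagonal_conjTranspose]
    congr 1
    ext i
    simp
  have hRDR : R * D * R = 1 := by
    rw [diagonal_mul_diagonal, diagonal_mul_diagonal, ← diagonal_one]
    congr 1
    ext i
    have h : (√(a i))⁻¹ * a i * (√(a i))⁻¹ = 1 := by
      have := Real.sqrt_pos.2 (ha i)
      field_simp
      exact (Real.sq_sqrt (ha i).le).symm
    exact_mod_cast h
  have h : star (U * R) * (U * D * star U) * (U * R) = 1 := by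
    rw [star_mul, hRs, show R * star U * (U * D * star U) * (U * R) =
      R * (star U * U) * D * (star U * U) * R by simp only [mul_assoc], hUU, mul_one, mul_one, hRDR]
  exact ⟨U * R, IsUnit.of_mul_eq_one_right _ h, h⟩

end Matrix

theorem deltaS2_comm {d : ℕ} (X Y : Matrix (Fin d) (Fin d) ℂ) : deltaS2 X Y = deltaS2 Y X := by
  unfold deltaS2
  rw [add_comm X Y]
  ring

theorem Matrix.PosDef.half_smul_add {n : Type*} [Fintype n] {X Y : Matrix n n ℂ}
    (hX : X.PosDef) (hY : Y.PosDef) : ((1 / 2 : ℝ) • (X + Y)).PosDef :=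
  (hX.add hY).smul (by norm_num)

theorem deltaS2_conj {d : ℕ} {S X Y : Matrix (Fin d) (Fin d) ℂ} (hS : IsUnit S)
    (hX : X.PosDef) (hY : Y.PosDef) :
    deltaS2 (star S * X * S) (star S * Y * S) = deltaS2 X Y := by
  have hS' : 0 < Complex.normSq S.det :=
    Complex.normSq_pos.2 ((isUnit_iff_isUnit_det S).1 hS).ne_zero
  have hdet (A : Matrix (Fin d) (Fin d) ℂ) :
      (star S * A * S).det.re = Complex.normSq S.det * A.det.re := by
    rw [det_mul, det_mul, star_eq_conjTranspose, det_conjTranspose, mul_right_comm,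
      RCLike.star_def, ← Complex.normSq_eq_conj_mul_self, Complex.re_ofReal_mul]
  have hlog {A : Matrix (Fin d) (Fin d) ℂ} (hA : A.PosDef) :
      Real.log (star S * A * S).det.re = Real.log (Complex.normSq S.det) + Real.log A.det.re := by
    rw [hdet, Real.log_mul hS'.ne' hA.det_re_pos.ne']
  have hmid : (1 / 2 : ℝ) • (star S * X * S + star S * Y * S) =
      star S * ((1 / 2 : ℝ) • (X + Y)) * S := by
    rw [mul_smul_comm, smul_mul_assoc, mul_add, add_mul]
  unfold deltaS2
  rw [hmid, hlog (hX.half_smul_add hY), hlog hX, hlog hY]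
  ring

theorem deltaS2_one_unitary_conj {d : ℕ} {U : Matrix (Fin d) (Fin d) ℂ}
    (hU : U ∈ unitaryGroup (Fin d) ℂ) {a : Fin d → ℝ} (ha : ∀ i, 0 < a i) :
    deltaS2 1 (U * diagonal (fun i => (a i : ℂ)) * star U) =
      ∑ i, Real.log (Real.cosh (Real.log (a i) / 2)) := by
  have hmid : (1 / 2 : ℝ) • (1 + U * diagonal (fun i => (a i : ℂ)) * star U) =
      U * diagonal (fun i => (((1 + a i) / 2 : ℝ) : ℂ)) * star U := by
    have hD : diagonal (fun i => (((1 + a i) / 2 : ℝ) : ℂ)) =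
        (1 / 2 : ℝ) • (1 + diagonal (fun i => (a i : ℂ))) := by
      rw [← diagonal_one, diagonal_add, ← diagonal_smul]
      congr 1
      ext i
      simp
      ring
    rw [hD, mul_smul_comm, smul_mul_assoc, mul_add, add_mul, mul_one, mem_unitaryGroup_iff.1 hU]
  unfold deltaS2
  rw [hmid, log_det_unitary_conj_diagonal hU ha,
    log_det_unitary_conj_diagonal hU fun i => by have := ha i; positivity]
  simp only [det_one, Complex.one_re, Real.log_one, mul_zero, sub_zero, Finset.mul_sum,
    ← Finset.sum_sub_distrib]
  refine Finset.sum_congr rfl fun i _ => ?_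
  have h := Real.log_add_div_two_sub_eq_log_cosh one_pos (ha i)
  rwa [Real.log_one, mul_zero, sub_zero, zero_sub, neg_div, Real.cosh_neg] at h

theorem deltaS2_one_nonneg {d : ℕ} {Y : Matrix (Fin d) (Fin d) ℂ} (hY : Y.PosDef) :
    0 ≤ deltaS2 1 Y := by
  obtain ⟨U, hU, a, ha, rfl⟩ := hY.exists_unitary_diagonal
  rw [deltaS2_one_unitary_conj hU ha]
  exact Finset.sum_nonneg fun i _ => Real.log_cosh_nonneg _

theorem deltaS2_one_eq_zero_iff {d : ℕ} {Y : Matrix (Fin d) (Fin d) ℂ} (hY : Y.PosDef) :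
    deltaS2 1 Y = 0 ↔ 1 = Y := by
  obtain ⟨U, hU, a, ha, rfl⟩ := hY.exists_unitary_diagonal
  constructor
  · intro h
    rw [deltaS2_one_unitary_conj hU ha,
      Finset.sum_eq_zero_iff_of_nonneg fun i _ => Real.log_cosh_nonneg _] at h
    have ha1 (i : Fin d) : a i = 1 := by
      by_contra hne
      have hlog : Real.log (a i) / 2 ≠ 0 :=
        div_ne_zero (Real.log_ne_zero_of_pos_of_ne_one (ha i) hne) two_ne_zero
      exact (Real.log_pos (Real.one_lt_cosh.2 hlog)).ne' (h i (Finset.mem_univ i))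
    simp only [ha1, Complex.ofReal_one, diagonal_one, mul_one, mem_unitaryGroup_iff.1 hU]
  · intro h
    rw [← h]
    simp [deltaS2, ← two_smul ℝ (1 : Matrix (Fin d) (Fin d) ℂ), smul_smul]

theorem sqrt_deltaS2_one_le {d : ℕ} {Y Z : Matrix (Fin d) (Fin d) ℂ} (hY : Y.PosDef)
    (hZ : Z.PosDef) : √(deltaS2 1 Z) ≤ √(deltaS2 1 Y) + √(deltaS2 Y Z) := by
  have hC := hY.half_smul_add hZ
  obtain ⟨U, hU, y, hy, rfl⟩ := hY.exists_unitary_diagonal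
  obtain ⟨V, hV, z, hz, rfl⟩ := hZ.exists_unitary_diagonal
  obtain ⟨M, hM, N, hN, hlog⟩ := exists_unitary_log_det_midpoint_ge hU hV hy hz hC
  have hYZ : ∑ p : Fin d × Fin d × Fin d, ‖M p.1 p.2.1‖ ^ 2 * ‖N p.1 p.2.2‖ ^ 2 *
      Real.log (Real.cosh ((Real.log (y p.2.1) - Real.log (z p.2.2)) / 2)) ≤
      deltaS2 (U * diagonal (fun i => (y i : ℂ)) * star U)
        (V * diagonal (fun i => (z i : ℂ)) * star V) := by
    unfold deltaS2
    rw [log_det_unitary_conj_diagonal hU hy, log_det_unitary_conj_diagonal hV hz,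
      ← sum_unitary_weights_fst hM hN (fun i => Real.log (y i)),
      ← sum_unitary_weights_snd hM hN (fun i => Real.log (z i))]
    refine le_trans (le_of_eq ?_) (sub_le_sub_right (sub_le_sub_right hlog _) _)
    simp only [Finset.mul_sum, ← Finset.sum_sub_distrib]
    refine Finset.sum_congr rfl fun p _ => ?_
    rw [← Real.log_add_div_two_sub_eq_log_cosh (hy _) (hz _)]
    ring
  rw [deltaS2_one_unitary_conj hU hy, deltaS2_one_unitary_conj hV hz,
    ← sum_unitary_weights_fst hM hN (fun i => Real.log (Real.cosh (Real.log (y i) / 2))),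
    ← sum_unitary_weights_snd hM hN (fun i => Real.log (Real.cosh (Real.log (z i) / 2)))]
  refine le_trans ?_ (add_le_add_right (Real.sqrt_le_sqrt hYZ) _)
  refine Real.sqrt_sum_mul_le_add _ _ _ _ _ (fun p => by positivity)
    (fun p => Real.log_cosh_nonneg _) (fun p => Real.log_cosh_nonneg _) fun p => ?_
  have h := Real.sqrt_log_cosh_add_le (Real.log (y p.2.1) / 2)
    (-((Real.log (y p.2.1) - Real.log (z p.2.2)) / 2))
  rw [Real.cosh_neg] at h
  convert h using 4
  ring

/-- **Theorem (Sra 2016)**: `δ_S = (δ_S²)^{1/2}` is a metric on `ℙ_d`. -/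
theorem deltaS_is_metric {d : ℕ} (X Y Z : Matrix (Fin d) (Fin d) ℂ)
    (hX : X.PosDef) (hY : Y.PosDef) (hZ : Z.PosDef) :
    0 ≤ deltaS2 X Y ∧
    (deltaS2 X Y = 0 ↔ X = Y) ∧
    deltaS2 X Y = deltaS2 Y X ∧
    Real.sqrt (deltaS2 X Z) ≤ Real.sqrt (deltaS2 X Y) + Real.sqrt (deltaS2 Y Z) := by
  obtain ⟨S, hS, hSX⟩ := hX.exists_conj_eq_one
  have hconj {A : Matrix (Fin d) (Fin d) ℂ} (hA : A.PosDef) : (star S * A * S).PosDef :=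
    (IsUnit.posDef_star_left_conjugate_iff hS).2 hA
  have hXA {A : Matrix (Fin d) (Fin d) ℂ} (hA : A.PosDef) :
      deltaS2 X A = deltaS2 1 (star S * A * S) := by
    rw [← deltaS2_conj hS hX hA, hSX]
  refine ⟨?_, ?_, deltaS2_comm X Y, ?_⟩
  · rw [hXA hY]
    exact deltaS2_one_nonneg (hconj hY)
  · rw [hXA hY, deltaS2_one_eq_zero_iff (hconj hY), ← hSX,
      hS.mul_left_inj, hS.star.mul_right_inj]
  · rw [hXA hY, hXA hZ, ← deltaS2_conj hS hY hZ]
    exact sqrt_deltaS2_one_le (hconj hY) (hconj hZ)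
end

section
/- For every α ∈ (0,1) and every x > 0, one has x^α = (α·sin(απ)/π) · ∫₀^∞ log((t+x)/t) · t^{α−1} dt. -/
open MeasureTheory

theorem lintegral_ofReal_of_integral_eq {s : Set ℝ} (hs : MeasurableSet s) {f : ℝ → ℝ} {c : ℝ}
    (hf : ∀ t ∈ s, 0 ≤ f t) (hc : 0 < c) (h : ∫ t in s, f t = c) :
    ∫⁻ t in s, ENNReal.ofReal (f t) = ENNReal.ofReal c := by
  rw [← h, ofReal_integral_eq_lintegral_ofReal]
  · exact Integrable.of_integral_ne_zero (h ▸ hc.ne')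
  · exact (ae_restrict_iff' hs).2 (.of_forall hf)

theorem lintegral_rpow_mul_exp_neg_mul_Ioi {a r : ℝ} (ha : 0 < a) (hr : 0 < r) :
    ∫⁻ t in Set.Ioi (0:ℝ), ENNReal.ofReal (t ^ (a - 1) * Real.exp (-(r * t))) =
      ENNReal.ofReal ((1 / r) ^ a * Real.Gamma a) := by
  refine lintegral_ofReal_of_integral_eq measurableSet_Ioi (fun t ht => ?_) ?_
    (Real.integral_rpow_mul_exp_neg_mul_Ioi ha hr)
  · have := Real.rpow_nonneg (le_of_lt ht) (a - 1)
    positivity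
  · have := Real.Gamma_pos_of_pos ha
    positivity

theorem lintegral_rpow_div_add_Ioi {a y : ℝ} (ha : a ∈ Set.Ioo (0:ℝ) 1) (hy : 0 < y) :
    ∫⁻ t in Set.Ioi (0:ℝ), ENNReal.ofReal (t ^ (a - 1) / (t + y)) =
      ENNReal.ofReal (Real.pi / Real.sin (a * Real.pi) * y ^ (a - 1)) := by
  have h1a : 0 < 1 - a := sub_pos.2 ha.2
  calc ∫⁻ t in Set.Ioi (0:ℝ), ENNReal.ofReal (t ^ (a - 1) / (t + y))
      = ∫⁻ t in Set.Ioi (0:ℝ), ∫⁻ s in Set.Ioi (0:ℝ),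
          ENNReal.ofReal (t ^ (a - 1) * Real.exp (-((t + y) * s))) := by
        refine setLIntegral_congr_fun measurableSet_Ioi fun t ht => ?_
        have ht : 0 < t := ht
        have h := lintegral_rpow_mul_exp_neg_mul_Ioi one_pos (add_pos ht hy)
        simp only [sub_self, Real.rpow_zero, one_mul, Real.rpow_one, Real.Gamma_one,
          mul_one] at h
        have h0 := Real.rpow_nonneg ht.le (a - 1)
        simp only [ENNReal.ofReal_mul h0]
        rw [lintegral_const_mul _ (by fun_prop), h, ← ENNReal.ofReal_mul h0, mul_one_div]
    _ = ∫⁻ s in Set.Ioi (0:ℝ), ∫⁻ t in Set.Ioi (0:ℝ),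
          ENNReal.ofReal (t ^ (a - 1) * Real.exp (-((t + y) * s))) := by
        refine lintegral_lintegral_swap ?_
        exact Measurable.aemeasurable (by fun_prop)
    _ = ∫⁻ s in Set.Ioi (0:ℝ), ENNReal.ofReal (Real.Gamma a) *
          ENNReal.ofReal (s ^ (1 - a - 1) * Real.exp (-(y * s))) := by
        refine setLIntegral_congr_fun measurableSet_Ioi fun s hs => ?_
        have hs : 0 < s := hs
        have hG := (Real.Gamma_pos_of_pos ha.1).le
        have h (t : ℝ) : ENNReal.ofReal (t ^ (a - 1) * Real.exp (-((t + y) * s))) =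
            ENNReal.ofReal (Real.exp (-(y * s))) *
              ENNReal.ofReal (t ^ (a - 1) * Real.exp (-(s * t))) := by
          rw [← ENNReal.ofReal_mul (Real.exp_nonneg _), mul_left_comm, ← Real.exp_add]
          ring_nf
        simp only [h]
        rw [lintegral_const_mul _ (by fun_prop), lintegral_rpow_mul_exp_neg_mul_Ioi ha.1 hs,
          ← ENNReal.ofReal_mul (Real.exp_nonneg _), ← ENNReal.ofReal_mul hG, one_div,
          Real.inv_rpow hs.le, ← Real.rpow_neg hs.le, show 1 - a - 1 = -a by ring]
        ring_nf
    _ = ENNReal.ofReal (Real.pi / Real.sin (a * Real.pi) * y ^ (a - 1)) := by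
        rw [lintegral_const_mul _ (by fun_prop), lintegral_rpow_mul_exp_neg_mul_Ioi h1a hy,
          ← ENNReal.ofReal_mul (Real.Gamma_pos_of_pos ha.1).le, mul_left_comm,
          Real.Gamma_mul_Gamma_one_sub, one_div, Real.inv_rpow hy.le, ← Real.rpow_neg hy.le,
          neg_sub, mul_comm, mul_comm a]

theorem lintegral_one_div_add_Ioc {t x : ℝ} (ht : 0 < t) (hx : 0 < x) :
    ∫⁻ y in Set.Ioc 0 x, ENNReal.ofReal (1 / (t + y)) =
      ENNReal.ofReal (Real.log ((t + x) / t)) := by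
  refine lintegral_ofReal_of_integral_eq measurableSet_Ioc (fun y hy => ?_) ?_ ?_
  · have := hy.1
    positivity
  · exact Real.log_pos ((one_lt_div ht).2 (by linarith))
  · rw [← intervalIntegral.integral_of_le hx.le,
      intervalIntegral.integral_comp_add_left (fun u => 1 / u) t, add_zero,
      integral_one_div_of_pos ht (by positivity)]

theorem lintegral_rpow_sub_one_Ioc {a x : ℝ} (ha : 0 < a) (hx : 0 < x) :
    ∫⁻ y in Set.Ioc 0 x, ENNReal.ofReal (y ^ (a - 1)) = ENNReal.ofReal (x ^ a / a) := by
  refine lintegral_ofReal_of_integral_eq measurableSet_Ioc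
    (fun y hy => Real.rpow_nonneg hy.1.le _) (by positivity) ?_
  rw [← intervalIntegral.integral_of_le hx.le, integral_rpow (.inl (by linarith)),
    sub_add_cancel, Real.zero_rpow ha.ne', sub_zero]

theorem lintegral_log_div_mul_rpow_Ioi {a x : ℝ} (ha : a ∈ Set.Ioo (0:ℝ) 1) (hx : 0 < x) :
    ∫⁻ t in Set.Ioi (0:ℝ), ENNReal.ofReal (Real.log ((t + x) / t) * t ^ (a - 1)) =
      ENNReal.ofReal (Real.pi / Real.sin (a * Real.pi) * (x ^ a / a)) := by
  have hsin : 0 < Real.sin (a * Real.pi) :=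
    Real.sin_pos_of_pos_of_lt_pi (mul_pos ha.1 Real.pi_pos)
      (mul_lt_of_lt_one_left Real.pi_pos ha.2)
  have hC : 0 ≤ Real.pi / Real.sin (a * Real.pi) := by positivity
  calc ∫⁻ t in Set.Ioi (0:ℝ), ENNReal.ofReal (Real.log ((t + x) / t) * t ^ (a - 1))
      = ∫⁻ t in Set.Ioi (0:ℝ), ∫⁻ y in Set.Ioc 0 x, ENNReal.ofReal (t ^ (a - 1) / (t + y)) := by
        refine setLIntegral_congr_fun measurableSet_Ioi fun t ht => ?_
        have h0 := Real.rpow_nonneg (le_of_lt ht) (a - 1)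
        simp only [div_eq_mul_one_div (t ^ (a - 1)), ENNReal.ofReal_mul h0]
        rw [lintegral_const_mul _ (by fun_prop), lintegral_one_div_add_Ioc ht hx,
          ← ENNReal.ofReal_mul h0, mul_comm]
    _ = ∫⁻ y in Set.Ioc 0 x, ∫⁻ t in Set.Ioi (0:ℝ), ENNReal.ofReal (t ^ (a - 1) / (t + y)) := by
        refine lintegral_lintegral_swap ?_
        exact Measurable.aemeasurable (by fun_prop)
    _ = ∫⁻ y in Set.Ioc 0 x, ENNReal.ofReal (Real.pi / Real.sin (a * Real.pi)) *
          ENNReal.ofReal (y ^ (a - 1)) := by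
        refine setLIntegral_congr_fun measurableSet_Ioc fun y hy => ?_
        simp only [← ENNReal.ofReal_mul hC, lintegral_rpow_div_add_Ioi ha hy.1]
    _ = ENNReal.ofReal (Real.pi / Real.sin (a * Real.pi) * (x ^ a / a)) := by
        rw [lintegral_const_mul _ (by fun_prop), lintegral_rpow_sub_one_Ioc ha.1 hx,
          ← ENNReal.ofReal_mul hC]

/-- For `α ∈ (0,1)` and `x > 0`:
`x^α = (α·sin(απ)/π) · ∫₀^∞ log((t+x)/t) · t^(α−1) dt`. -/
theorem rpow_eq_integral_log_div (α : ℝ) (hα : α ∈ Set.Ioo (0:ℝ) 1) (x : ℝ) (hx : 0 < x) :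
    x ^ α = (α * Real.sin (α * Real.pi) / Real.pi) *
      ∫ t in Set.Ioi (0:ℝ), Real.log ((t + x) / t) * t ^ (α - 1) := by
  have hα0 : 0 < α := hα.1
  have hsin : 0 < Real.sin (α * Real.pi) :=
    Real.sin_pos_of_pos_of_lt_pi (mul_pos hα.1 Real.pi_pos)
      (mul_lt_of_lt_one_left Real.pi_pos hα.2)
  rw [integral_eq_lintegral_of_nonneg_ae, lintegral_log_div_mul_rpow_Ioi hα hx,
    ENNReal.toReal_ofReal (by positivity)]
  · field_simp
  · refine (ae_restrict_iff' measurableSet_Ioi).2 (.of_forall fun t ht => ?_)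
    have ht : 0 < t := ht
    exact mul_nonneg (Real.log_nonneg ((one_le_div ht).2 (by linarith)))
      (Real.rpow_nonneg ht.le _)
  · exact Measurable.aestronglyMeasurable (by fun_prop)
end

section
/- For every α ∈ (1,2) and every x > 0, one has x^α = (|α·sin(απ)|/π) · ∫₀^∞ (t·x − log(1+t·x)) · t^{−α−1} dt. -/
open MeasureTheory

open Set Filter Topology

/-- The real Beta integral `∫₀¹ y^(s-1) (1-y)^(-s) dy` in closed form. -/
theorem integral_Ioo_rpow_mul_one_sub_rpow_neg {s : ℝ} (hs : s ∈ Ioo (0 : ℝ) 1) :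
    ∫ y in Ioo (0 : ℝ) 1, y ^ (s - 1) * (1 - y) ^ (-s) = Real.pi / Real.sin (Real.pi * s) := by
  have hbeta := Complex.betaIntegral_eq_Gamma_mul_div (s : ℂ) ((1 - s : ℝ) : ℂ)
    (by simpa using hs.1) (by simpa using hs.2)
  have hsum : (s : ℂ) + ((1 - s : ℝ) : ℂ) = 1 := by push_cast; ring
  rw [hsum, Complex.Gamma_one, div_one, Complex.Gamma_ofReal, Complex.Gamma_ofReal,
    ← Complex.ofReal_mul, Real.Gamma_mul_Gamma_one_sub] at hbeta
  rw [← Complex.ofReal_inj, ← hbeta, Complex.betaIntegral,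
    intervalIntegral.integral_of_le zero_le_one, integral_Ioc_eq_integral_Ioo,
    ← integral_complex_ofReal]
  refine setIntegral_congr_fun measurableSet_Ioo fun y hy => ?_
  have hy' : 0 ≤ 1 - y := by linarith [hy.2]
  simp only [Complex.ofReal_mul]
  rw [Complex.ofReal_cpow hy.1.le, Complex.ofReal_cpow hy']
  push_cast
  ring_nf

theorem image_div_one_add_Ioi : (fun u : ℝ => u / (1 + u)) '' Ioi 0 = Ioo 0 1 := by
  ext y
  constructor
  · rintro ⟨u, hu, rfl⟩
    have hu : 0 < u := hu
    exact ⟨by positivity, by rw [div_lt_one (by positivity)]; linarith⟩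
  · rintro ⟨h0, h1⟩
    have h : 0 < 1 - y := by linarith
    refine ⟨y / (1 - y), div_pos h0 h, ?_⟩
    field_simp
    ring

/-- The Mellin transform of `1 / (1 + u)`. -/
theorem integral_Ioi_rpow_div_one_add {s : ℝ} (hs : s ∈ Ioo (0 : ℝ) 1) :
    ∫ u in Ioi (0 : ℝ), u ^ (s - 1) / (1 + u) = Real.pi / Real.sin (Real.pi * s) := by
  have hderiv : ∀ u ∈ Ioi (0 : ℝ),
      HasDerivWithinAt (fun u : ℝ => u / (1 + u)) (1 / (1 + u) ^ 2) (Ioi 0) u := by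
    intro u (hu : 0 < u)
    have h := (hasDerivAt_id u).div ((hasDerivAt_id u).const_add 1) (by simp; positivity)
    refine (h.congr_deriv ?_).hasDerivWithinAt
    simp
  have hinj : InjOn (fun u : ℝ => u / (1 + u)) (Ioi 0) := by
    intro a (ha : 0 < a) b (hb : 0 < b) hab
    simp only at hab
    rw [div_eq_div_iff (by positivity) (by positivity)] at hab
    linarith
  rw [← integral_Ioo_rpow_mul_one_sub_rpow_neg hs, ← image_div_one_add_Ioi,
    integral_image_eq_integral_abs_deriv_smul measurableSet_Ioi hderiv hinj]
  refine setIntegral_congr_fun measurableSet_Ioi fun u hu => ?_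
  have hu : 0 < u := hu
  have h1 : 0 < 1 + u := by positivity
  have h2 : 1 - u / (1 + u) = (1 + u)⁻¹ := by field_simp; ring
  simp only [smul_eq_mul]
  rw [h2, abs_of_pos (by positivity), Real.div_rpow hu.le h1.le, Real.inv_rpow h1.le,
    Real.rpow_neg h1.le, inv_inv, Real.rpow_sub_one h1.ne']
  have := (Real.rpow_pos_of_pos h1 s).ne'
  field_simp

theorem integrableOn_Ioi_rpow_div_one_add {s : ℝ} (hs : s ∈ Ioo (0 : ℝ) 1) :
    IntegrableOn (fun u : ℝ => u ^ (s - 1) / (1 + u)) (Ioi 0) := by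
  by_contra h
  have hsin : 0 < Real.sin (Real.pi * s) :=
    Real.sin_pos_of_pos_of_lt_pi (mul_pos Real.pi_pos hs.1)
      (by nlinarith [Real.pi_pos, hs.2])
  exact (div_pos Real.pi_pos hsin).ne ((integral_undef h).symm.trans
    (integral_Ioi_rpow_div_one_add hs))

theorem sub_log_one_add_nonneg {u : ℝ} (hu : 0 < u) : 0 ≤ u - Real.log (1 + u) := by
  linarith [Real.log_le_sub_one_of_pos (show 0 < 1 + u by linarith)]

theorem sub_log_one_add_le {u : ℝ} (hu : 0 < u) : u - Real.log (1 + u) ≤ u ^ 2 / (1 + u) := by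
  have h := Real.one_sub_inv_le_log_of_pos (show 0 < 1 + u by linarith)
  have : u ^ 2 / (1 + u) = u - (1 - (1 + u)⁻¹) := by field_simp; ring
  linarith

/-- The Mellin-type integral of `u - log (1 + u)`. -/
theorem integral_Ioi_sub_log_mul_rpow {α : ℝ} (hα : α ∈ Ioo (1 : ℝ) 2) :
    ∫ u in Ioi (0 : ℝ), (u - Real.log (1 + u)) * u ^ (-α - 1) =
      Real.pi / (α * Real.sin (Real.pi * (2 - α))) := by
  have hα0 : 0 < α := by linarith [hα.1]
  have hs : 2 - α ∈ Ioo (0 : ℝ) 1 := ⟨by linarith [hα.2], by linarith [hα.1]⟩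
  have hint := integrableOn_Ioi_rpow_div_one_add hs
  have hpow : ∀ u : ℝ, 0 < u → u ^ 2 * u ^ (-α - 1) = u ^ (2 - α - 1) := by
    intro u hu
    rw [← Real.rpow_natCast, ← Real.rpow_add hu]
    congr 1
    push_cast
    ring
  have hu : ∀ u ∈ Ioi (0 : ℝ),
      HasDerivAt (fun u : ℝ => u - Real.log (1 + u)) (u / (1 + u)) u := by
    intro u (hu : 0 < u)
    have h1 : (1 + u) ≠ 0 := by positivity
    have h := (hasDerivAt_id u).sub (((hasDerivAt_id u).const_add 1).log h1)
    refine h.congr_deriv ?_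
    simp only [id]
    field_simp
    ring
  have hv : ∀ u ∈ Ioi (0 : ℝ),
      HasDerivAt (fun u : ℝ => -(1 / α) * u ^ (-α)) (u ^ (-α - 1)) u := by
    intro u (hu : 0 < u)
    refine ((Real.hasDerivAt_rpow_const (p := -α) (Or.inl hu.ne')).const_mul
      (-(1 / α))).congr_deriv ?_
    field_simp
  have hprod : ∀ u ∈ Ioi (0 : ℝ), u / (1 + u) * (-(1 / α) * u ^ (-α)) =
      -(1 / α) * (u ^ (2 - α - 1) / (1 + u)) := by
    intro u (hu : 0 < u)
    have : u ^ (2 - α - 1) = u * u ^ (-α) := by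
      rw [← hpow u hu, Real.rpow_sub_one hu.ne']
      field_simp
    rw [this]
    ring
  have huv' : IntegrableOn ((fun u : ℝ => u - Real.log (1 + u)) * fun u => u ^ (-α - 1))
      (Ioi 0) := by
    refine hint.mono' ?_ ?_
    · exact Measurable.aestronglyMeasurable (by fun_prop)
    · filter_upwards [ae_restrict_mem measurableSet_Ioi] with u hu
      have hu : 0 < u := hu
      have hp := Real.rpow_pos_of_pos hu (-α - 1)
      rw [Pi.mul_apply, Real.norm_of_nonneg (mul_nonneg (sub_log_one_add_nonneg hu) hp.le),
        ← hpow u hu, mul_div_right_comm]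
      exact mul_le_mul_of_nonneg_right (sub_log_one_add_le hu) hp.le
  have hu'v : IntegrableOn ((fun u : ℝ => u / (1 + u)) * fun u => -(1 / α) * u ^ (-α))
      (Ioi 0) :=
    (integrableOn_congr_fun hprod measurableSet_Ioi).2 (hint.const_mul _)
  have hbound : ∀ u : ℝ, 0 < u →
      ‖(u - Real.log (1 + u)) * (-(1 / α) * u ^ (-α))‖ ≤ 1 / α * (u ^ (2 - α) / (1 + u)) := by
    intro u hu
    have hp := Real.rpow_pos_of_pos hu (-α)
    have h2 : u ^ (2 - α) = u ^ 2 * u ^ (-α) := by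
      rw [sub_eq_add_neg, Real.rpow_add hu, Real.rpow_two]
    rw [norm_mul, Real.norm_of_nonneg (sub_log_one_add_nonneg hu), norm_mul, norm_neg,
      Real.norm_of_nonneg hp.le, Real.norm_of_nonneg (by positivity), h2]
    have := mul_le_mul_of_nonneg_right (sub_log_one_add_le hu)
      (show 0 ≤ 1 / α * u ^ (-α) by positivity)
    exact this.trans_eq (by ring)
  have h_zero : Tendsto ((fun u : ℝ => u - Real.log (1 + u)) * fun u => -(1 / α) * u ^ (-α))
      (𝓝[>] 0) (𝓝 0) := by
    have hlim : Tendsto (fun u : ℝ => 1 / α * u ^ (2 - α)) (𝓝[>] 0) (𝓝 0) := by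
      have h := ((Real.continuousAt_rpow_const 0 (2 - α) (Or.inr hs.1.le)).tendsto.const_mul
        (1 / α)).mono_left (nhdsWithin_le_nhds (s := Ioi 0))
      simpa [Real.zero_rpow hs.1.ne'] using h
    refine squeeze_zero_norm' ?_ hlim
    filter_upwards [self_mem_nhdsWithin] with u hu
    have hu : 0 < u := hu
    refine (hbound u hu).trans ?_
    gcongr
    exact div_le_self (by positivity) (by linarith)
  have h_infty : Tendsto ((fun u : ℝ => u - Real.log (1 + u)) * fun u => -(1 / α) * u ^ (-α))
      atTop (𝓝 0) := by
    have hlim : Tendsto (fun u : ℝ => 1 / α * u ^ (-(α - 1))) atTop (𝓝 0) := by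
      simpa using (tendsto_rpow_neg_atTop (show 0 < α - 1 by linarith [hα.1])).const_mul (1 / α)
    refine squeeze_zero_norm' ?_ hlim
    filter_upwards [eventually_gt_atTop 0] with u hu
    refine (hbound u hu).trans ?_
    rw [show -(α - 1) = 2 - α - 1 by ring, Real.rpow_sub_one hu.ne']
    gcongr
    linarith
  rw [integral_Ioi_mul_deriv_eq_deriv_mul hu hv huv' hu'v h_zero h_infty,
    setIntegral_congr_fun measurableSet_Ioi hprod, integral_const_mul,
    integral_Ioi_rpow_div_one_add hs, div_mul_eq_div_div_swap]
  ring

/-- For `α ∈ (1,2)` and `x > 0`: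
`x^α = (|α·sin(απ)|/π) · ∫₀^∞ (t·x − log(1+t·x)) · t^(−α−1) dt`. -/
theorem rpow_eq_integral_sub_log (α : ℝ) (hα : α ∈ Set.Ioo (1:ℝ) 2) (x : ℝ) (hx : 0 < x) :
    x ^ α = (|α * Real.sin (α * Real.pi)| / Real.pi) *
      ∫ t in Set.Ioi (0:ℝ), (t * x - Real.log (1 + t * x)) * t ^ (-α - 1) := by
  have hα0 : 0 < α := by linarith [hα.1]
  have hsin : 0 < Real.sin (Real.pi * (2 - α)) :=
    Real.sin_pos_of_pos_of_lt_pi (mul_pos Real.pi_pos (by linarith [hα.2]))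
      (by nlinarith [Real.pi_pos, hα.1])
  have hsin' : Real.sin (α * Real.pi) = -Real.sin (Real.pi * (2 - α)) := by
    rw [show Real.pi * (2 - α) = 2 * Real.pi - α * Real.pi by ring, Real.sin_two_pi_sub, neg_neg]
  have hscale : ∫ t in Ioi (0 : ℝ), (t * x - Real.log (1 + t * x)) * t ^ (-α - 1) =
      x ^ α * ∫ u in Ioi (0 : ℝ), (u - Real.log (1 + u)) * u ^ (-α - 1) := by
    have h := integral_comp_mul_right_Ioi
      (fun u : ℝ => (u - Real.log (1 + u)) * u ^ (-α - 1)) 0 hx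
    rw [zero_mul, smul_eq_mul, inv_mul_eq_div, eq_div_iff hx.ne'] at h
    rw [← h, mul_comm _ x, ← mul_assoc, ← integral_const_mul]
    refine setIntegral_congr_fun measurableSet_Ioi fun t ht => ?_
    have ht : 0 < t := ht
    have hp := (Real.rpow_pos_of_pos hx α).ne'
    rw [Real.mul_rpow ht.le hx.le, Real.rpow_sub_one hx.ne', Real.rpow_neg hx.le]
    field_simp
  rw [hscale, integral_Ioi_sub_log_mul_rpow hα, hsin', mul_neg, abs_neg,
    abs_of_pos (mul_pos hα0 hsin)]
  have := Real.pi_pos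
  field_simp
end

section
/- For every α ∈ (0,1), the function √(QJSD_α) is a metric on ℙ_d: QJSD_α(X,Y) ≥ 0 with equality iff X = Y, QJSD_α(X,Y) = QJSD_α(Y,X), and √(QJSD_α(X,Z)) ≤ √(QJSD_α(X,Y)) + √(QJSD_α(Y,Z)) for all X, Y, Z ∈ ℙ_d. -/
open Matrix
open scoped ComplexOrder

/-- The α-Tsallis entropy `S_α(X) = (tr(X^α) − tr X)/(1−α)`. -/
noncomputable def tsallisEntropy {d : ℕ} (α : ℝ) (X : Matrix (Fin d) (Fin d) ℂ) : ℝ :=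
  (traceF (fun x => x ^ α) X - traceF (fun x => x) X) / (1 - α)

/-- The quantum Jensen-Shannon-Tsallis divergence
`QJSD_α(X,Y) = S_α((X+Y)/2) − (1/2)(S_α(X)+S_α(Y))`. -/
noncomputable def qjsdα {d : ℕ} (α : ℝ) (X Y : Matrix (Fin d) (Fin d) ℂ) : ℝ :=
  tsallisEntropy α ((1 / 2 : ℝ) • (X + Y))
    - (1 / 2) * (tsallisEntropy α X + tsallisEntropy α Y)

open Filter Topology MeasureTheory

/-! ### The scalar divergence `log ((x + y) / 2) - (log x + log y) / 2` -/

theorem antitoneOn_log_cosh_div_sq :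
    AntitoneOn (fun s : ℝ => Real.log (Real.cosh s) / s ^ 2) (Set.Ioi 0) := by
  have hder : ∀ s : ℝ, HasDerivAt (fun s => Real.log (Real.cosh s))
      (Real.sinh s / Real.cosh s) s := fun s =>
    (Real.hasDerivAt_cosh s).log (Real.cosh_pos s).ne'
  have hkey : ∀ s : ℝ, 0 ≤ s →
      s * (Real.sinh s / Real.cosh s) ≤ 2 * Real.log (Real.cosh s) := by
    have hd : ∀ s : ℝ, HasDerivAt
        (fun s => s * (Real.sinh s / Real.cosh s) - 2 * Real.log (Real.cosh s))
        ((1 * (Real.sinh s / Real.cosh s) + s * ((Real.cosh s * Real.cosh s -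
          Real.sinh s * Real.sinh s) / Real.cosh s ^ 2)) - 2 * (Real.sinh s / Real.cosh s)) s :=
      fun s => ((hasDerivAt_id s).mul ((Real.hasDerivAt_sinh s).div (Real.hasDerivAt_cosh s)
        (Real.cosh_pos s).ne')).sub ((hder s).const_mul 2)
    have hanti := antitoneOn_of_deriv_nonpos (convex_Ici (0 : ℝ))
      (fun s _ => (hd s).continuousAt.continuousWithinAt)
      (fun s _ => (hd s).differentiableAt.differentiableWithinAt) (by
        intro s hs
        rw [interior_Ici] at hs
        have hs0 : (0 : ℝ) < s := hs
        rw [(hd s).deriv]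
        have hc := Real.cosh_pos s
        have h1 := Real.self_le_sinh_iff.2 hs0.le
        have h2 := Real.one_le_cosh s
        have h3 := Real.cosh_sq s
        have h4 : Real.cosh s * Real.cosh s - Real.sinh s * Real.sinh s = 1 := by nlinarith
        rw [h4]
        have h5 : 1 * (Real.sinh s / Real.cosh s) + s * (1 / Real.cosh s ^ 2)
            - 2 * (Real.sinh s / Real.cosh s)
            = (s - Real.sinh s * Real.cosh s) / Real.cosh s ^ 2 := by
          field_simp; ring
        rw [h5]
        apply div_nonpos_of_nonpos_of_nonneg _ (by positivity)
        nlinarith)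
    intro s hs
    have := hanti Set.self_mem_Ici hs hs
    simp at this
    linarith
  have hd : ∀ s : ℝ, 0 < s → HasDerivAt (fun s => Real.log (Real.cosh s) / s ^ 2)
      (((Real.sinh s / Real.cosh s) * s ^ 2 - Real.log (Real.cosh s) * (2 * s)) / (s ^ 2) ^ 2) s :=
    fun s hs => by
      have h2 : HasDerivAt (fun s : ℝ => s ^ 2) (2 * s) s := by simpa using hasDerivAt_pow 2 s
      exact (hder s).div h2 (by positivity)
  refine antitoneOn_of_deriv_nonpos (convex_Ioi 0)
    (fun s hs => (hd s hs).continuousAt.continuousWithinAt)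
    (fun s hs => (hd s (interior_subset hs)).differentiableAt.differentiableWithinAt) ?_
  intro s hs
  have hs0 : 0 < s := interior_subset hs
  rw [(hd s hs0).deriv]
  apply div_nonpos_of_nonpos_of_nonneg _ (by positivity)
  nlinarith [hkey s hs0.le]

theorem log_cosh_add_le {lam : ℝ} (h0 : 0 < lam) (h1 : lam < 1) (s t : ℝ) :
    Real.log (Real.cosh (s + t)) ≤
      Real.log (Real.cosh s) / lam + Real.log (Real.cosh t) / (1 - lam) := by
  have h1' : 0 < 1 - lam := by linarith
  have hnn : ∀ r, 0 ≤ Real.log (Real.cosh r) := fun r => Real.log_nonneg (Real.one_le_cosh r)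
  have hmono : ∀ r r' : ℝ, |r| ≤ |r'| → Real.log (Real.cosh r) ≤ Real.log (Real.cosh r') :=
    fun r r' h => Real.log_le_log (Real.cosh_pos r) (Real.cosh_le_cosh.2 h)
  have hd1 : ∀ r, Real.log (Real.cosh r) ≤ Real.log (Real.cosh r) / lam := fun r =>
    le_div_self (hnn r) h0 h1.le
  have hd2 : ∀ r, Real.log (Real.cosh r) ≤ Real.log (Real.cosh r) / (1 - lam) := fun r =>
    le_div_self (hnn r) h1' (by linarith)
  rcases le_total |s + t| |s| with hs | hs
  · have := div_nonneg (hnn t) h1'.le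
    linarith [hmono _ _ hs, hd1 s]
  rcases le_total |s + t| |t| with ht | ht
  · have := div_nonneg (hnn s) h0.le
    linarith [hmono _ _ ht, hd2 t]
  rcases eq_or_ne (s + t) 0 with h | hne
  · rw [h]
    have := div_nonneg (hnn s) h0.le
    have := div_nonneg (hnn t) h1'.le
    simp; linarith
  have hpos : 0 < |s + t| := abs_pos.2 hne
  set K := Real.log (Real.cosh (s + t)) / (s + t) ^ 2 with hK
  have hbound : ∀ r : ℝ, |r| ≤ |s + t| → r ^ 2 * K ≤ Real.log (Real.cosh r) := by
    intro r hr
    rcases eq_or_ne r 0 with rfl | hr0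
    · simp
    have := antitoneOn_log_cosh_div_sq (abs_pos.2 hr0) hpos hr
    simp only [Real.cosh_abs, sq_abs] at this
    rw [le_div_iff₀ (by positivity)] at this
    linarith
  have hK0 : 0 ≤ K := div_nonneg (hnn _) (sq_nonneg _)
  have hsq : (s + t) ^ 2 ≤ s ^ 2 / lam + t ^ 2 / (1 - lam) := by
    rw [div_add_div _ _ h0.ne' h1'.ne', le_div_iff₀ (by positivity)]
    nlinarith [sq_nonneg ((1 - lam) * s - lam * t)]
  calc Real.log (Real.cosh (s + t)) = (s + t) ^ 2 * K := by
        rw [hK]; field_simp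
    _ ≤ (s ^ 2 / lam + t ^ 2 / (1 - lam)) * K := by gcongr
    _ = s ^ 2 * K / lam + t ^ 2 * K / (1 - lam) := by ring
    _ ≤ _ := by
        gcongr
        · exact hbound s hs
        · exact hbound t ht

/-- The Jensen gap of the logarithm at two points. -/
noncomputable def logGap (x y : ℝ) : ℝ :=
  Real.log ((x + y) / 2) - (Real.log x + Real.log y) / 2

theorem logGap_eq_log_cosh {x y : ℝ} (hx : 0 < x) (hy : 0 < y) :
    logGap x y = Real.log (Real.cosh ((Real.log x - Real.log y) / 2)) := by
  have h : (x + y) / 2 = Real.exp ((Real.log x + Real.log y) / 2) *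
      Real.cosh ((Real.log x - Real.log y) / 2) := by
    rw [Real.cosh_eq, mul_div_assoc', mul_add, ← Real.exp_add, ← Real.exp_add]
    ring_nf
    rw [Real.exp_log hx, Real.exp_log hy]
  rw [logGap, h, Real.log_mul (Real.exp_pos _).ne' (Real.cosh_pos _).ne', Real.log_exp]
  ring

theorem logGap_le {lam x y z : ℝ} (h0 : 0 < lam) (h1 : lam < 1)
    (hx : 0 < x) (hy : 0 < y) (hz : 0 < z) :
    logGap x z ≤ logGap x y / lam + logGap y z / (1 - lam) := by
  rw [logGap_eq_log_cosh hx hz, logGap_eq_log_cosh hx hy, logGap_eq_log_cosh hy hz]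
  convert log_cosh_add_le h0 h1 ((Real.log x - Real.log y) / 2) ((Real.log y - Real.log z) / 2)
    using 3
  ring_nf

theorem logGap_pos {x y : ℝ} (hx : 0 < x) (hy : 0 < y) (h : x ≠ y) : 0 < logGap x y := by
  rw [logGap_eq_log_cosh hx hy]
  refine Real.log_pos (Real.one_lt_cosh.2 ?_)
  have := fun e => h (Real.log_injOn_pos hx hy e)
  intro e
  apply this; linarith

theorem logGap_self (x : ℝ) : logGap x x = 0 := by
  rw [logGap, add_self_div_two, add_self_div_two, sub_self]

/-- If `√p ≤ √q + √r` in its linearized form, then it holds. -/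
theorem sqrt_le_sqrt_add_sqrt_of_forall {p q r : ℝ} (hq : 0 ≤ q) (hr : 0 ≤ r)
    (h : ∀ lam : ℝ, 0 < lam → lam < 1 → p ≤ q / lam + r / (1 - lam)) :
    √p ≤ √q + √r := by
  have key : ∀ ε : ℝ, 0 < ε → √p ≤ (√q + ε) + (√r + ε) := by
    intro ε hε
    set a := √q + ε
    set b := √r + ε
    have ha : 0 < a := by positivity
    have hb : 0 < b := by positivity
    have hqa : q ≤ a ^ 2 := by
      rw [← Real.sq_sqrt hq]; gcongr; simp only [a]; linarith
    have hrb : r ≤ b ^ 2 := by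
      rw [← Real.sq_sqrt hr]; gcongr; simp only [b]; linarith
    refine Real.sqrt_le_iff.2 ⟨by positivity, ?_⟩
    have hl := h (a / (a + b)) (by positivity) ((div_lt_one (by positivity)).2 (by linarith))
    have e : 1 - a / (a + b) = b / (a + b) := by field_simp; ring
    rw [e] at hl
    calc p ≤ q / (a / (a + b)) + r / (b / (a + b)) := hl
      _ ≤ a ^ 2 / (a / (a + b)) + b ^ 2 / (b / (a + b)) := by gcongr
      _ = (a + b) ^ 2 := by field_simp
  refine le_of_forall_pos_le_add fun ε hε => ?_
  have := key (ε / 2) (by positivity)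
  linarith

/-! ### From resolvents to logarithms -/

theorem sum_mul_log_nonneg {ι : Type*} [Fintype ι] (w x : ι → ℝ) (hx : ∀ i, 0 < x i)
    (hw : ∑ i, w i = 0) (h : ∀ t : ℝ, 0 < t → ∑ i, w i / (x i + t) ≤ 0) :
    0 ≤ ∑ i, w i * Real.log (x i) := by
  have hd : ∀ t : ℝ, 0 ≤ t → HasDerivAt (fun t => ∑ i, w i * Real.log (t + x i))
      (∑ i, w i * (1 / (t + x i))) t := fun t ht =>
    HasDerivAt.fun_sum fun i _ =>
      (((hasDerivAt_id t).add_const (x i)).log (by have := hx i; simp; linarith)).const_mul (w i)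
  have hanti := antitoneOn_of_deriv_nonpos (convex_Ici (0 : ℝ))
    (fun s hs => (hd s hs).continuousAt.continuousWithinAt)
    (fun s hs => (hd s (interior_subset hs)).differentiableAt.differentiableWithinAt) (by
      intro s hs
      rw [interior_Ici] at hs
      rw [(hd s (le_of_lt hs)).deriv]
      convert h s hs using 2 with i
      rw [mul_one_div, add_comm])
  have hlim : Tendsto (fun t => ∑ i, w i * Real.log (t + x i)) atTop (𝓝 0) := by
    have h1 : Tendsto (fun t => ∑ i, w i * (Real.log (t + x i) - Real.log t)) atTop
        (𝓝 (∑ i, w i * 0)) :=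
      tendsto_finsetSum _ fun i _ => (Real.tendsto_log_comp_add_sub_log (x i)).const_mul (w i)
    simp only [mul_zero, Finset.sum_const_zero] at h1
    refine h1.congr fun t => ?_
    simp only [mul_sub, Finset.sum_sub_distrib, ← Finset.sum_mul, hw, zero_mul, sub_zero]
  have := le_of_tendsto hlim ((eventually_ge_atTop 0).mono fun t ht =>
    hanti Set.self_mem_Ici ht ht)
  simpa using this

/-! ### Powers as integrals of logarithms -/

theorem integrableOn_rpow_mul_log_one_add_inv {α : ℝ} (h0 : 0 < α) (h1 : α < 1) :
    IntegrableOn (fun t : ℝ => t ^ (α - 1) * Real.log (1 + 1 / t)) (Set.Ioi 0) := by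
  have hmeas : Measurable (fun t : ℝ => t ^ (α - 1) * Real.log (1 + 1 / t)) := by fun_prop
  have hlog : ∀ t : ℝ, 0 < t → 0 ≤ Real.log (1 + 1 / t) := fun t ht =>
    Real.log_nonneg (by have : 0 < 1 / t := by positivity
                        linarith)
  have hU : Set.Ioi (0 : ℝ) = Set.Ioc 0 1 ∪ Set.Ioi 1 := (Set.Ioc_union_Ioi_eq_Ioi zero_le_one).symm
  rw [hU]
  refine IntegrableOn.union ?_ ?_
  · have hb : IntegrableOn (fun t : ℝ => (2 ^ (α / 2) / (α / 2)) * t ^ (α / 2 - 1))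
        (Set.Ioc 0 1) := by
      refine Integrable.const_mul ?_ _
      rw [← IntegrableOn, integrableOn_Ioc_iff_integrableOn_Ioo,
        intervalIntegral.integrableOn_Ioo_rpow_iff one_pos]
      linarith
    refine Integrable.mono' hb hmeas.aestronglyMeasurable ?_
    refine (ae_restrict_iff' measurableSet_Ioc).2 (Eventually.of_forall fun t ht => ?_)
    have ht0 : 0 < t := ht.1
    rw [Real.norm_of_nonneg (mul_nonneg (by positivity) (hlog t ht0))]
    have h2 : 1 + 1 / t ≤ 2 / t := by
      have : 1 ≤ 1 / t := (one_le_div ht0).2 ht.2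
      have e : 2 / t = 1 / t + 1 / t := by ring
      linarith
    calc t ^ (α - 1) * Real.log (1 + 1 / t) ≤ t ^ (α - 1) * ((2 / t) ^ (α / 2) / (α / 2)) := by
          gcongr
          exact (Real.log_le_log (by positivity) h2).trans
            (Real.log_le_rpow_div (by positivity) (by positivity))
      _ = _ := by
          rw [Real.div_rpow (by norm_num) ht0.le,
            show α / 2 - 1 = (α - 1) - α / 2 by ring, Real.rpow_sub ht0 (α - 1) (α / 2)]
          ring
  · have hb : IntegrableOn (fun t : ℝ => t ^ (α - 2)) (Set.Ioi 1) :=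
      integrableOn_Ioi_rpow_of_lt (by linarith) one_pos
    refine Integrable.mono' hb hmeas.aestronglyMeasurable ?_
    refine (ae_restrict_iff' measurableSet_Ioi).2 (Eventually.of_forall fun t ht => ?_)
    have ht0 : 0 < t := lt_trans one_pos ht
    rw [Real.norm_of_nonneg (mul_nonneg (by positivity) (hlog t ht0))]
    calc t ^ (α - 1) * Real.log (1 + 1 / t) ≤ t ^ (α - 1) * (1 / t) := by
          gcongr
          have := Real.log_le_sub_one_of_pos (show 0 < 1 + 1 / t by positivity)
          linarith
      _ = _ := by
          rw [show α - 2 = (α - 1) - 1 by ring, Real.rpow_sub ht0 (α - 1) 1, Real.rpow_one]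
          ring

theorem setIntegral_Ioi_pos {f : ℝ → ℝ} (hf : IntegrableOn f (Set.Ioi 0))
    (hpos : ∀ t, 0 < t → 0 < f t) : 0 < ∫ t in Set.Ioi 0, f t := by
  rw [setIntegral_pos_iff_support_of_nonneg_ae ((ae_restrict_iff' measurableSet_Ioi).2
    (Eventually.of_forall fun t ht => (hpos t ht).le)) hf]
  have : Function.support f ∩ Set.Ioi 0 = Set.Ioi 0 :=
    Set.inter_eq_right.2 fun t ht => (hpos t ht).ne'
  simp [this]

/-- The constant in `rpowLogConst α * x ^ α = ∫ t in Ioi 0, t ^ (α - 1) * log (1 + x / t)`. -/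
noncomputable def rpowLogConst (α : ℝ) : ℝ :=
  ∫ t in Set.Ioi (0 : ℝ), t ^ (α - 1) * Real.log (1 + 1 / t)

theorem rpowLogConst_pos {α : ℝ} (h0 : 0 < α) (h1 : α < 1) : 0 < rpowLogConst α := by
  refine setIntegral_Ioi_pos (integrableOn_rpow_mul_log_one_add_inv h0 h1) fun t ht => ?_
  have h : 0 < 1 / t := by positivity
  exact mul_pos (Real.rpow_pos_of_pos ht _) (Real.log_pos (by linarith))

theorem integrableOn_rpow_mul_log {α : ℝ} (h0 : 0 < α) (h1 : α < 1) {x : ℝ} (hx : 0 < x) :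
    IntegrableOn (fun t : ℝ => t ^ (α - 1) * Real.log (1 + x / t)) (Set.Ioi 0) := by
  have := (integrableOn_Ioi_comp_mul_left_iff
    (fun t : ℝ => t ^ (α - 1) * Real.log (1 + x / t)) 0 hx).1 (by
      refine IntegrableOn.congr_fun
        ((integrableOn_rpow_mul_log_one_add_inv h0 h1).const_mul (x ^ (α - 1)))
        (fun t ht => ?_) measurableSet_Ioi
      have ht0 : 0 < t := ht
      rw [Real.mul_rpow hx.le ht0.le, ← mul_assoc, div_mul_cancel_left₀ hx.ne', one_div])
  simpa using this

theorem integral_rpow_mul_log {α x : ℝ} (hx : 0 < x) :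
    ∫ t in Set.Ioi (0 : ℝ), t ^ (α - 1) * Real.log (1 + x / t) = rpowLogConst α * x ^ α := by
  have h := integral_comp_mul_left_Ioi
    (fun t : ℝ => t ^ (α - 1) * Real.log (1 + x / t)) 0 hx
  have e : ∫ t in Set.Ioi (0 : ℝ), (x * t) ^ (α - 1) * Real.log (1 + x / (x * t)) =
      x ^ (α - 1) * rpowLogConst α := by
    rw [rpowLogConst, ← integral_const_mul]
    refine setIntegral_congr_fun measurableSet_Ioi fun t ht => ?_
    have ht0 : 0 < t := ht
    rw [Real.mul_rpow hx.le ht0.le, ← mul_assoc, div_mul_cancel_left₀ hx.ne', one_div]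
  rw [mul_zero, smul_eq_mul, e] at h
  rw [Real.rpow_sub hx, Real.rpow_one] at h
  field_simp at h
  linarith

/-! ### The logarithmic determinant -/

section

variable {d : ℕ}

/-- The logarithm of the determinant of a positive definite matrix. -/
noncomputable def logDet (X : Matrix (Fin d) (Fin d) ℂ) : ℝ := Real.log X.det.re

theorem Matrix.PosDef.det_re_pos_s5 {X : Matrix (Fin d) (Fin d) ℂ} (hX : X.PosDef) :
    0 < X.det.re := (Complex.lt_def.1 hX.det_pos).1

theorem Matrix.PosDef.ofReal_det_re {X : Matrix (Fin d) (Fin d) ℂ} (hX : X.PosDef) :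
    (X.det.re : ℂ) = X.det :=
  Complex.ext rfl (Complex.lt_def.1 hX.det_pos).2

theorem Matrix.IsHermitian.eq_mul_diagonal_mul {X : Matrix (Fin d) (Fin d) ℂ}
    (hX : X.IsHermitian) :
    X = (hX.eigenvectorUnitary : Matrix (Fin d) (Fin d) ℂ) *
      diagonal (fun i => (hX.eigenvalues i : ℂ)) *
      (hX.eigenvectorUnitary : Matrix (Fin d) (Fin d) ℂ)ᴴ := by
  have := hX.spectral_theorem
  rwa [Unitary.conjStarAlgAut_apply] at this

theorem logDet_conj {X W : Matrix (Fin d) (Fin d) ℂ} (hX : X.PosDef) (hW : W.det ≠ 0) :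
    logDet (Wᴴ * X * W) = logDet X + Real.log (Complex.normSq W.det) := by
  have h : (Wᴴ * X * W).det = ((X.det.re * Complex.normSq W.det : ℝ) : ℂ) := by
    rw [det_mul, det_mul, det_conjTranspose, Complex.ofReal_mul, hX.ofReal_det_re,
      Complex.normSq_eq_conj_mul_self]
    simp only [RCLike.star_def]
    ring
  rw [logDet, h, Complex.ofReal_re, Real.log_mul hX.det_re_pos_s5.ne'
    (Complex.normSq_pos.2 hW).ne', logDet]

theorem logDet_diagonal {a : Fin d → ℝ} (ha : ∀ i, 0 < a i) :
    logDet (diagonal fun i => (a i : ℂ)) = ∑ i, Real.log (a i) := by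
  rw [logDet, det_diagonal, ← Complex.ofReal_prod, Complex.ofReal_re,
    Real.log_prod fun i _ => (ha i).ne']

theorem Matrix.PosDef.add_real_smul_one {X : Matrix (Fin d) (Fin d) ℂ} (hX : X.PosDef) {t : ℝ}
    (ht : 0 < t) : (X + t • (1 : Matrix (Fin d) (Fin d) ℂ)).PosDef :=
  hX.add (PosDef.one.smul ht)

theorem Matrix.PosDef.midpoint {X Y : Matrix (Fin d) (Fin d) ℂ} (hX : X.PosDef) (hY : Y.PosDef) :
    ((1 / 2 : ℝ) • (X + Y)).PosDef :=
  (hX.add hY).smul (by norm_num : (0 : ℝ) < 1 / 2)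

theorem Matrix.IsHermitian.add_smul_one_eq {X : Matrix (Fin d) (Fin d) ℂ}
    (hX : X.IsHermitian) (t : ℝ) :
    X + t • (1 : Matrix (Fin d) (Fin d) ℂ) =
      (hX.eigenvectorUnitary : Matrix (Fin d) (Fin d) ℂ) *
      diagonal (fun i => ((hX.eigenvalues i + t : ℝ) : ℂ)) *
      (hX.eigenvectorUnitary : Matrix (Fin d) (Fin d) ℂ)ᴴ := by
  have hU : (hX.eigenvectorUnitary : Matrix (Fin d) (Fin d) ℂ) *
      (hX.eigenvectorUnitary : Matrix (Fin d) (Fin d) ℂ)ᴴ = 1 :=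
    Unitary.coe_mul_star_self _
  have hD : diagonal (fun i => ((hX.eigenvalues i + t : ℝ) : ℂ)) =
      diagonal (fun i => (hX.eigenvalues i : ℂ)) + t • (1 : Matrix (Fin d) (Fin d) ℂ) := by
    ext i j
    by_cases h : i = j <;> simp [diagonal, h]
  rw [hD, mul_add, add_mul, ← hX.eq_mul_diagonal_mul]
  simp [hU]

theorem Matrix.PosDef.logDet_add_smul_one {X : Matrix (Fin d) (Fin d) ℂ} (hX : X.PosDef)
    {t : ℝ} (ht : 0 ≤ t) :
    logDet (X + t • (1 : Matrix (Fin d) (Fin d) ℂ)) =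
      ∑ i, Real.log (hX.1.eigenvalues i + t) := by
  have hU : (hX.1.eigenvectorUnitary : Matrix (Fin d) (Fin d) ℂ).det *
      (hX.1.eigenvectorUnitary : Matrix (Fin d) (Fin d) ℂ)ᴴ.det = 1 := by
    rw [← det_mul]
    exact (congrArg det (Unitary.coe_mul_star_self _)).trans det_one
  have hpos : ∀ i, 0 < hX.1.eigenvalues i + t := fun i => by
    have := hX.eigenvalues_pos i
    linarith
  rw [← logDet_diagonal hpos, logDet, logDet, hX.1.add_smul_one_eq t, det_mul, det_mul,
    mul_right_comm, hU, one_mul]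

theorem Matrix.PosDef.logDet_eq {X : Matrix (Fin d) (Fin d) ℂ} (hX : X.PosDef) :
    logDet X = ∑ i, Real.log (hX.1.eigenvalues i) := by
  simpa using hX.logDet_add_smul_one le_rfl

theorem Matrix.PosDef.trace_inv_add_smul_one {X : Matrix (Fin d) (Fin d) ℂ} (hX : X.PosDef)
    {t : ℝ} (ht : 0 ≤ t) :
    (X + t • (1 : Matrix (Fin d) (Fin d) ℂ))⁻¹.trace =
      ((∑ i, 1 / (hX.1.eigenvalues i + t) : ℝ) : ℂ) := by
  set U := (hX.1.eigenvectorUnitary : Matrix (Fin d) (Fin d) ℂ) with hUdef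
  have hU : U * Uᴴ = 1 := Unitary.coe_mul_star_self _
  have hU' : Uᴴ * U = 1 := Unitary.coe_star_mul_self _
  have hpos : ∀ i, 0 < hX.1.eigenvalues i + t := fun i => by
    have := hX.eigenvalues_pos i
    linarith
  have hinv : (X + t • (1 : Matrix (Fin d) (Fin d) ℂ))⁻¹ =
      U * diagonal (fun i => ((1 / (hX.1.eigenvalues i + t) : ℝ) : ℂ)) * Uᴴ := by
    refine inv_eq_right_inv ?_
    rw [hX.1.add_smul_one_eq t, ← hUdef]
    calc _ = U * (diagonal (fun i => ((hX.1.eigenvalues i + t : ℝ) : ℂ)) * (Uᴴ * U) *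
          diagonal (fun i => ((1 / (hX.1.eigenvalues i + t) : ℝ) : ℂ))) * Uᴴ := by
          simp only [Matrix.mul_assoc]
      _ = 1 := by
          rw [hU', Matrix.mul_one, diagonal_mul_diagonal]
          have : (fun i => ((hX.1.eigenvalues i + t : ℝ) : ℂ) *
              ((1 / (hX.1.eigenvalues i + t) : ℝ) : ℂ)) = fun _ => 1 := by
            ext i
            rw [← Complex.ofReal_mul, mul_one_div_cancel (hpos i).ne', Complex.ofReal_one]
          rw [this, diagonal_one, Matrix.mul_one, hU]
  rw [hinv, trace_mul_cycle, hU', Matrix.one_mul, trace_diagonal, Complex.ofReal_sum]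

theorem trace_mul_diagonal_mul_conjTranspose_re (V : Matrix (Fin d) (Fin d) ℂ) (b : Fin d → ℝ) :
    (V * diagonal (fun i => (b i : ℂ)) * Vᴴ).trace.re =
      ∑ i, ∑ j, b j * Complex.normSq (V i j) := by
  simp only [trace, diag, Complex.re_sum]
  refine Finset.sum_congr rfl fun i _ => ?_
  rw [mul_apply, Complex.re_sum]
  refine Finset.sum_congr rfl fun j _ => ?_
  rw [mul_diagonal, conjTranspose_apply]
  simp [Complex.normSq_apply]
  ring

/-- The trace inequality `tr (A + B)⁻¹ ≤ ⟨1, (L_A + R_B)⁻¹ 1⟩`, where `A` is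
diagonal and `B` is diagonalized by `U`. -/
theorem trace_inv_le_sum {a b : Fin d → ℝ} (ha : ∀ i, 0 < a i) (hb : ∀ i, 0 < b i)
    {U : Matrix (Fin d) (Fin d) ℂ} (hU : U * Uᴴ = 1)
    {M : Matrix (Fin d) (Fin d) ℂ} (hM : M.PosDef)
    (hMeq : M = diagonal (fun i => (a i : ℂ)) + U * diagonal (fun i => (b i : ℂ)) * Uᴴ) :
    M⁻¹.trace.re ≤ ∑ i, ∑ j, Complex.normSq (U i j) / (a i + b j) := by
  have hdet : IsUnit M.det := hM.det_pos.ne'.isUnit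
  set Y := M⁻¹ with hY
  have hYh : Yᴴ = Y := by rw [hY, conjTranspose_nonsing_inv, hM.1.eq]
  set V := Y * U with hV
  have hVh : Vᴴ = Uᴴ * Y := by rw [hV, conjTranspose_mul, hYh]
  have h1 : (∑ i, ∑ j, (star (V i j) * U i j).re) = Y.trace.re := by
    have : (Vᴴ * U).trace = Y.trace := by
      rw [hVh, trace_mul_comm, ← Matrix.mul_assoc, hU, Matrix.one_mul]
    rw [← this, Finset.sum_comm]
    simp [trace, mul_apply]
  have h2 : (∑ i, ∑ j, (a i + b j) * Complex.normSq (V i j)) = Y.trace.re := by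
    have e1 : (∑ i, ∑ j, a i * Complex.normSq (V i j)) =
        (Vᴴ * diagonal (fun i => (a i : ℂ)) * V).trace.re := by
      have := trace_mul_diagonal_mul_conjTranspose_re Vᴴ a
      rw [conjTranspose_conjTranspose] at this
      rw [this, Finset.sum_comm]
      simp
    have e2 := (trace_mul_diagonal_mul_conjTranspose_re V b).symm
    have e3 : (Vᴴ * diagonal (fun i => (a i : ℂ)) * V).trace =
        (Y * diagonal (fun i => (a i : ℂ)) * Y).trace := by
      rw [hVh, hV, show Uᴴ * Y * diagonal (fun i => (a i : ℂ)) * (Y * U) =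
        Uᴴ * (Y * diagonal (fun i => (a i : ℂ)) * Y * U) by simp only [Matrix.mul_assoc],
        trace_mul_comm, Matrix.mul_assoc _ U, hU, Matrix.mul_one]
    have e4 : V * diagonal (fun i => (b i : ℂ)) * Vᴴ =
        Y * (U * diagonal (fun i => (b i : ℂ)) * Uᴴ) * Y := by
      rw [hVh, hV]; simp only [Matrix.mul_assoc]
    simp only [add_mul, Finset.sum_add_distrib]
    rw [e1, e2, e3, e4, ← Complex.add_re, ← trace_add, ← add_mul, ← mul_add, ← hMeq, hY,
      nonsing_inv_mul _ hdet, Matrix.one_mul]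
  have h3 : ∀ i j, 2 * (star (V i j) * U i j).re - (a i + b j) * Complex.normSq (V i j) ≤
      Complex.normSq (U i j) / (a i + b j) := by
    intro i j
    have hc : 0 < a i + b j := add_pos (ha i) (hb j)
    rw [le_div_iff₀ hc]
    simp only [Complex.normSq_apply, RCLike.star_def, Complex.mul_re, Complex.conj_re,
      Complex.conj_im]
    nlinarith [sq_nonneg ((U i j).re - (a i + b j) * (V i j).re),
      sq_nonneg ((U i j).im - (a i + b j) * (V i j).im)]
  calc Y.trace.re = 2 * (∑ i, ∑ j, (star (V i j) * U i j).re) -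
        ∑ i, ∑ j, (a i + b j) * Complex.normSq (V i j) := by rw [h1, h2]; ring
    _ = ∑ i, ∑ j, (2 * (star (V i j) * U i j).re -
        (a i + b j) * Complex.normSq (V i j)) := by
        simp only [Finset.sum_sub_distrib, Finset.mul_sum]
    _ ≤ _ := Finset.sum_le_sum fun i _ => Finset.sum_le_sum fun j _ => h3 i j

theorem sum_normSq_row {U : Matrix (Fin d) (Fin d) ℂ} (hU : U * Uᴴ = 1) (i : Fin d) :
    ∑ j, Complex.normSq (U i j) = 1 := by
  have h := congrArg Complex.re (congrFun (congrFun hU i) i)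
  simp only [mul_apply, conjTranspose_apply, one_apply_eq, Complex.one_re, Complex.re_sum] at h
  rw [← h]
  refine Finset.sum_congr rfl fun j _ => ?_
  simp [Complex.normSq_apply]

theorem sum_normSq_col {U : Matrix (Fin d) (Fin d) ℂ} (hU : U * Uᴴ = 1) (j : Fin d) :
    ∑ i, Complex.normSq (U i j) = 1 := by
  have h := sum_normSq_row (U := Uᴴ) (by
    rw [conjTranspose_conjTranspose]; exact mul_eq_one_comm.1 hU) j
  simpa using h

/-- A Fiedler-type lower bound for the determinant of a sum. -/
theorem sum_log_le_logDet {a b : Fin d → ℝ} (ha : ∀ i, 0 < a i) (hb : ∀ i, 0 < b i)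
    {U : Matrix (Fin d) (Fin d) ℂ} (hU : U * Uᴴ = 1)
    {M : Matrix (Fin d) (Fin d) ℂ} (hM : M.PosDef)
    (hMeq : M = diagonal (fun i => (a i : ℂ)) + U * diagonal (fun i => (b i : ℂ)) * Uᴴ) :
    ∑ i, ∑ j, Complex.normSq (U i j) * Real.log (a i + b j) ≤ logDet M := by
  have key := sum_mul_log_nonneg (ι := Fin d ⊕ (Fin d × Fin d))
    (Sum.elim (fun _ => 1) fun p => -Complex.normSq (U p.1 p.2))
    (Sum.elim hM.1.eigenvalues fun p => a p.1 + b p.2)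
    (by rintro (i | ⟨i, j⟩)
        · exact hM.eigenvalues_pos i
        · exact add_pos (ha i) (hb j))
    (by simp [Fintype.sum_sum_type, Fintype.sum_prod_type, sum_normSq_row hU])
    (by
      intro t ht
      have h := trace_inv_le_sum (a := fun i => a i + t) (fun i => add_pos (ha i) ht) hb hU
        (hM.add_real_smul_one ht) (by
          have hD : diagonal (fun i => ((a i + t : ℝ) : ℂ)) =
              diagonal (fun i => (a i : ℂ)) + t • (1 : Matrix (Fin d) (Fin d) ℂ) := by
            ext i j
            by_cases h : i = j <;> simp [diagonal, h, one_apply]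
          rw [hD, hMeq]; abel)
      rw [hM.trace_inv_add_smul_one ht.le, Complex.ofReal_re] at h
      simp only [Fintype.sum_sum_type, Fintype.sum_prod_type, Sum.elim_inl, Sum.elim_inr,
        neg_div, Finset.sum_neg_distrib]
      simp only [add_right_comm _ t] at h
      linarith)
  simp only [Fintype.sum_sum_type, Fintype.sum_prod_type, Sum.elim_inl, Sum.elim_inr,
    neg_mul, Finset.sum_neg_distrib, one_mul] at key
  rw [hM.logDet_eq]
  linarith

/-! ### The log-determinant divergence -/

/-- The Jensen gap of the logarithmic determinant at two matrices. -/
noncomputable def logDetGap (X Y : Matrix (Fin d) (Fin d) ℂ) : ℝ :=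
  logDet ((1 / 2 : ℝ) • (X + Y)) - (logDet X + logDet Y) / 2

theorem Matrix.PosDef.conj {X W : Matrix (Fin d) (Fin d) ℂ} (hX : X.PosDef) (hW : W.det ≠ 0) :
    (Wᴴ * X * W).PosDef :=
  hX.conjTranspose_mul_mul_same
    (mulVec_injective_iff_isUnit.2 ((isUnit_iff_isUnit_det W).2 hW.isUnit))

theorem logDetGap_conj {X Y W : Matrix (Fin d) (Fin d) ℂ} (hX : X.PosDef) (hY : Y.PosDef)
    (hW : W.det ≠ 0) : logDetGap (Wᴴ * X * W) (Wᴴ * Y * W) = logDetGap X Y := by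
  have h : (1 / 2 : ℝ) • (Wᴴ * X * W + Wᴴ * Y * W) = Wᴴ * ((1 / 2 : ℝ) • (X + Y)) * W := by
    rw [Matrix.mul_smul, Matrix.smul_mul, mul_add, add_mul]
  rw [logDetGap, h, logDet_conj hX hW, logDet_conj hY hW, logDet_conj (hX.midpoint hY) hW,
    logDetGap]
  ring

theorem Matrix.PosDef.logDet_half_smul {X : Matrix (Fin d) (Fin d) ℂ} (hX : X.PosDef) :
    logDet ((1 / 2 : ℝ) • X) = logDet X - d * Real.log 2 := by
  have h : ((1 / 2 : ℝ) • X).det = (((1 / 2 : ℝ) ^ d * X.det.re : ℝ) : ℂ) := by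
    rw [← Complex.coe_smul, det_smul, Complex.ofReal_mul, hX.ofReal_det_re]
    simp
  rw [logDet, h, Complex.ofReal_re, Real.log_mul (by positivity) hX.det_re_pos_s5.ne',
    Real.log_pow, logDet, one_div, Real.log_inv]
  ring

theorem exists_conj_eq_one_and_diagonal {X Y : Matrix (Fin d) (Fin d) ℂ} (hX : X.PosDef)
    (hY : Y.PosDef) : ∃ (W : Matrix (Fin d) (Fin d) ℂ) (a : Fin d → ℝ), W.det ≠ 0 ∧
      Wᴴ * X * W = 1 ∧ Wᴴ * Y * W = diagonal (fun i => (a i : ℂ)) ∧ ∀ i, 0 < a i := by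
  set U := (hX.1.eigenvectorUnitary : Matrix (Fin d) (Fin d) ℂ) with hUdef
  have hU : U * Uᴴ = 1 := Unitary.coe_mul_star_self _
  have hU' : Uᴴ * U = 1 := Unitary.coe_star_mul_self _
  set S := diagonal (fun i => ((1 / √(hX.1.eigenvalues i) : ℝ) : ℂ)) with hS
  have hSh : Sᴴ = S := by
    rw [hS, diagonal_conjTranspose]
    congr 1
    ext i
    simp
  have hXone : (U * S)ᴴ * X * (U * S) = 1 := by
    rw [hX.1.eq_mul_diagonal_mul, ← hUdef, conjTranspose_mul, hSh]
    calc _ = S * (Uᴴ * U) * diagonal (fun i => (hX.1.eigenvalues i : ℂ)) * (Uᴴ * U) * S := by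
          simp only [Matrix.mul_assoc]
      _ = 1 := by
          rw [hU', Matrix.mul_one, Matrix.mul_one, hS, diagonal_mul_diagonal,
            diagonal_mul_diagonal, ← diagonal_one]
          congr 1
          ext i
          have hp := hX.eigenvalues_pos i
          rw [← Complex.ofReal_mul, ← Complex.ofReal_mul, ← Complex.ofReal_one]
          congr 1
          have hs := Real.sqrt_pos.2 hp
          field_simp
          rw [Real.sq_sqrt hp.le]
  have hdet : (U * S).det ≠ 0 := by
    intro h
    have := congrArg det hXone
    rw [det_mul, h, mul_zero, det_one] at this
    exact zero_ne_one this
  have hY' := hY.conj hdet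
  generalize hC : (U * S)ᴴ * Y * (U * S) = C at hY'
  set V := (hY'.1.eigenvectorUnitary : Matrix (Fin d) (Fin d) ℂ)
  have hV : V * Vᴴ = 1 := Unitary.coe_mul_star_self _
  have hV' : Vᴴ * V = 1 := Unitary.coe_star_mul_self _
  refine ⟨U * S * V, hY'.1.eigenvalues, ?_, ?_, ?_, hY'.eigenvalues_pos⟩
  · rw [det_mul]
    refine mul_ne_zero hdet fun h => ?_
    have := congrArg det hV
    simp [det_mul, h] at this
  · rw [conjTranspose_mul (U * S) V]
    calc _ = Vᴴ * ((U * S)ᴴ * X * (U * S)) * V := by simp only [Matrix.mul_assoc]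
      _ = 1 := by rw [hXone, Matrix.mul_one, hV']
  · rw [conjTranspose_mul (U * S) V]
    calc _ = Vᴴ * ((U * S)ᴴ * Y * (U * S)) * V := by simp only [Matrix.mul_assoc]
      _ = Vᴴ * C * V := by rw [hC]
      _ = Vᴴ * (V * diagonal (fun i => (hY'.1.eigenvalues i : ℂ)) * Vᴴ) * V :=
          congrArg (fun M => Vᴴ * M * V) hY'.1.eq_mul_diagonal_mul
      _ = (Vᴴ * V) * diagonal (fun i => (hY'.1.eigenvalues i : ℂ)) * (Vᴴ * V) := by
          simp only [Matrix.mul_assoc]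
      _ = _ := by rw [hV', Matrix.one_mul, Matrix.mul_one]

theorem logDet_one : logDet (1 : Matrix (Fin d) (Fin d) ℂ) = 0 := by
  simp [logDet]

theorem Matrix.PosDef.logDetGap_one_left {C : Matrix (Fin d) (Fin d) ℂ} (hC : C.PosDef) :
    logDetGap 1 C = ∑ j, logGap 1 (hC.1.eigenvalues j) := by
  have h : (1 + C).PosDef := PosDef.one.add hC
  have h1 : 1 + C = C + (1 : ℝ) • (1 : Matrix (Fin d) (Fin d) ℂ) := by rw [one_smul, add_comm]
  rw [logDetGap, h.logDet_half_smul, h1, hC.logDet_add_smul_one zero_le_one, logDet_one,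
    hC.logDet_eq]
  have e : ∀ j, logGap 1 (hC.1.eigenvalues j) = Real.log (hC.1.eigenvalues j + 1) - Real.log 2 -
      Real.log (hC.1.eigenvalues j) / 2 := fun j => by
    have := hC.eigenvalues_pos j
    rw [logGap, Real.log_div (by positivity) two_ne_zero, Real.log_one, add_comm]
    ring
  simp only [e, Finset.sum_sub_distrib, ← Finset.sum_div]
  simp

theorem posDef_diagonal_ofReal {a : Fin d → ℝ} (ha : ∀ i, 0 < a i) :
    (diagonal fun i => (a i : ℂ)).PosDef :=
  PosDef.diagonal fun i => by simpa using ha i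

theorem logDetGap_one_diagonal {a : Fin d → ℝ} (ha : ∀ i, 0 < a i) :
    logDetGap 1 (diagonal fun i => (a i : ℂ)) = ∑ i, logGap 1 (a i) := by
  have h : (1 / 2 : ℝ) • (1 + diagonal fun i => (a i : ℂ)) =
      diagonal (fun i => (((1 + a i) / 2 : ℝ) : ℂ)) := by
    ext i j
    by_cases h : i = j
    · subst h
      simp
      ring
    · simp [h]
  rw [logDetGap, h, logDet_diagonal fun i => by have := ha i; positivity, logDet_diagonal ha,
    logDet_one]
  simp only [logGap, Finset.sum_sub_distrib, ← Finset.sum_div, Real.log_one, zero_add]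

theorem sum_logGap_le_logDetGap {C : Matrix (Fin d) (Fin d) ℂ} (hC : C.PosDef) {a : Fin d → ℝ}
    (ha : ∀ i, 0 < a i) :
    ∑ i, ∑ j, Complex.normSq ((hC.1.eigenvectorUnitary : Matrix (Fin d) (Fin d) ℂ) i j) *
      logGap (hC.1.eigenvalues j) (a i) ≤ logDetGap C (diagonal fun i => (a i : ℂ)) := by
  set U := (hC.1.eigenvectorUnitary : Matrix (Fin d) (Fin d) ℂ) with hUdef
  have hU : U * Uᴴ = 1 := Unitary.coe_mul_star_self _
  have hM : (C + diagonal fun i => (a i : ℂ)).PosDef := hC.add (posDef_diagonal_ofReal ha)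
  have h := sum_log_le_logDet ha hC.eigenvalues_pos hU hM (by
    rw [hUdef, ← hC.1.eq_mul_diagonal_mul, add_comm])
  rw [logDetGap, hM.logDet_half_smul, hC.logDet_eq, logDet_diagonal ha]
  have e : ∀ i j, Complex.normSq (U i j) * logGap (hC.1.eigenvalues j) (a i) =
      Complex.normSq (U i j) * Real.log (a i + hC.1.eigenvalues j) -
      Complex.normSq (U i j) * Real.log 2 -
      (Complex.normSq (U i j) * Real.log (hC.1.eigenvalues j) / 2 +
      Complex.normSq (U i j) * (Real.log (a i) / 2)) := fun i j => by
    have := hC.eigenvalues_pos j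
    have := ha i
    rw [logGap, Real.log_div (by positivity) two_ne_zero,
      add_comm (hC.1.eigenvalues j) (a i)]
    ring
  have e1 : ∑ i, ∑ j, Complex.normSq (U i j) * Real.log (hC.1.eigenvalues j) / 2 =
      (∑ j, Real.log (hC.1.eigenvalues j)) / 2 := by
    rw [Finset.sum_comm, Finset.sum_div]
    refine Finset.sum_congr rfl fun j _ => ?_
    rw [← Finset.sum_div, ← Finset.sum_mul, sum_normSq_col hU, one_mul]
  simp only [e, Finset.sum_sub_distrib, Finset.sum_add_distrib, e1]
  simp only [← Finset.sum_mul, sum_normSq_row hU, one_mul, ← Finset.sum_div]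
  simp only [Finset.sum_const, Finset.card_univ, Fintype.card_fin, nsmul_eq_mul]
  linarith

theorem logDetGap_le {X Y Z : Matrix (Fin d) (Fin d) ℂ} (hX : X.PosDef) (hY : Y.PosDef)
    (hZ : Z.PosDef) {lam : ℝ} (h0 : 0 < lam) (h1 : lam < 1) :
    logDetGap X Z ≤ logDetGap X Y / lam + logDetGap Y Z / (1 - lam) := by
  obtain ⟨W, a, hW, hX1, hZa, ha⟩ := exists_conj_eq_one_and_diagonal hX hZ
  have hC := hY.conj hW
  rw [← logDetGap_conj hX hZ hW, ← logDetGap_conj hX hY hW, ← logDetGap_conj hY hZ hW, hX1, hZa,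
    logDetGap_one_diagonal ha, hC.logDetGap_one_left]
  have hge := sum_logGap_le_logDetGap hC ha
  set U := (hC.1.eigenvectorUnitary : Matrix (Fin d) (Fin d) ℂ)
  have hU : U * Uᴴ = 1 := Unitary.coe_mul_star_self _
  have h1' : 0 < 1 - lam := by linarith
  set b := hC.1.eigenvalues
  calc ∑ i, logGap 1 (a i) = ∑ i, ∑ j, Complex.normSq (U i j) * logGap 1 (a i) := by
        simp only [← Finset.sum_mul, sum_normSq_row hU, one_mul]
    _ ≤ ∑ i, ∑ j, Complex.normSq (U i j) *
          (logGap 1 (b j) / lam + logGap (b j) (a i) / (1 - lam)) :=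
        Finset.sum_le_sum fun i _ => Finset.sum_le_sum fun j _ =>
          mul_le_mul_of_nonneg_left (logGap_le h0 h1 one_pos (hC.eigenvalues_pos j) (ha i))
            (Complex.normSq_nonneg _)
    _ = (∑ j, ∑ i, Complex.normSq (U i j) * logGap 1 (b j)) / lam +
          (∑ i, ∑ j, Complex.normSq (U i j) * logGap (b j) (a i)) / (1 - lam) := by
        rw [Finset.sum_comm (f := fun j i => Complex.normSq (U i j) * logGap 1 (b j))]
        simp only [mul_add, Finset.sum_add_distrib, mul_div_assoc', Finset.sum_div]
    _ ≤ _ := by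
        simp only [← Finset.sum_mul, sum_normSq_col hU, one_mul]
        gcongr

theorem logDetGap_pos {X Y : Matrix (Fin d) (Fin d) ℂ} (hX : X.PosDef) (hY : Y.PosDef)
    (hXY : X ≠ Y) : 0 < logDetGap X Y := by
  obtain ⟨W, a, hW, hX1, hYa, ha⟩ := exists_conj_eq_one_and_diagonal hX hY
  rw [← logDetGap_conj hX hY hW, hX1, hYa, logDetGap_one_diagonal ha]
  have hne : ∃ i, (1 : ℝ) ≠ a i := by
    by_contra! h
    have hWu : IsUnit W := (isUnit_iff_isUnit_det W).2 hW.isUnit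
    have hWu' : IsUnit Wᴴ := (isUnit_iff_isUnit_det _).2 (by
      rw [det_conjTranspose]
      exact (star_ne_zero.2 hW).isUnit)
    refine hXY (hWu'.mul_left_cancel (hWu.mul_right_cancel (hX1.trans ?_)))
    rw [hYa]
    simp [← h]
  obtain ⟨i, hi⟩ := hne
  refine Finset.sum_pos' (fun j _ => ?_) ⟨i, Finset.mem_univ i, logGap_pos one_pos (ha i) hi⟩
  rcases eq_or_ne 1 (a j) with h | h
  · rw [← h, logGap_self]
  · exact (logGap_pos one_pos (ha j) h).le

/-! ### The Tsallis divergence as an integral of log-determinant divergences -/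

theorem tsallisEntropy_eq {α : ℝ} {X : Matrix (Fin d) (Fin d) ℂ} (hX : X.IsHermitian) :
    tsallisEntropy α X = ((∑ i, hX.eigenvalues i ^ α) - X.trace.re) / (1 - α) := by
  rw [tsallisEntropy, traceF, traceF, dif_pos hX, dif_pos hX, hX.trace_eq_sum_eigenvalues]
  simp

theorem Matrix.PosDef.integrableOn_logDet {α : ℝ} (h0 : 0 < α) (h1 : α < 1)
    {X : Matrix (Fin d) (Fin d) ℂ} (hX : X.PosDef) :
    IntegrableOn (fun t : ℝ => t ^ (α - 1) *
      (logDet (X + t • (1 : Matrix (Fin d) (Fin d) ℂ)) - d * Real.log t)) (Set.Ioi 0) ∧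
    ∫ t in Set.Ioi (0 : ℝ), t ^ (α - 1) *
      (logDet (X + t • (1 : Matrix (Fin d) (Fin d) ℂ)) - d * Real.log t) =
      rpowLogConst α * ∑ i, hX.1.eigenvalues i ^ α := by
  have e : Set.EqOn (fun t : ℝ => ∑ i, t ^ (α - 1) * Real.log (1 + hX.1.eigenvalues i / t))
      (fun t : ℝ => t ^ (α - 1) *
        (logDet (X + t • (1 : Matrix (Fin d) (Fin d) ℂ)) - d * Real.log t)) (Set.Ioi 0) := by
    intro t ht
    have ht0 : 0 < t := ht
    simp only
    rw [hX.logDet_add_smul_one ht0.le, ← Finset.mul_sum]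
    have : ∀ i, Real.log (1 + hX.1.eigenvalues i / t) =
        Real.log (hX.1.eigenvalues i + t) - Real.log t := fun i => by
      have := hX.eigenvalues_pos i
      rw [← Real.log_div (by positivity) ht0.ne', add_div, div_self ht0.ne', add_comm]
    simp [this]
  have hint := fun i => integrableOn_rpow_mul_log h0 h1 (hX.eigenvalues_pos i)
  refine ⟨IntegrableOn.congr_fun (integrable_finsetSum _ fun i _ => hint i) e
    measurableSet_Ioi, ?_⟩
  rw [← setIntegral_congr_fun measurableSet_Ioi e, integral_finsetSum _ fun i _ => hint i,
    Finset.mul_sum]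
  exact Finset.sum_congr rfl fun i _ => integral_rpow_mul_log (hX.eigenvalues_pos i)

theorem qjsdα_eq_integral {α : ℝ} (h0 : 0 < α) (h1 : α < 1) {X Y : Matrix (Fin d) (Fin d) ℂ}
    (hX : X.PosDef) (hY : Y.PosDef) :
    IntegrableOn (fun t : ℝ => t ^ (α - 1) *
      logDetGap (X + t • (1 : Matrix (Fin d) (Fin d) ℂ)) (Y + t • 1)) (Set.Ioi 0) ∧
    ∫ t in Set.Ioi (0 : ℝ), t ^ (α - 1) *
      logDetGap (X + t • (1 : Matrix (Fin d) (Fin d) ℂ)) (Y + t • 1) =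
      rpowLogConst α * (1 - α) * qjsdα α X Y := by
  have hM := hX.midpoint hY
  obtain ⟨iM, eM⟩ := hM.integrableOn_logDet h0 h1
  obtain ⟨iX, eX⟩ := hX.integrableOn_logDet h0 h1
  obtain ⟨iY, eY⟩ := hY.integrableOn_logDet h0 h1
  set F := fun (Q : Matrix (Fin d) (Fin d) ℂ) (t : ℝ) => t ^ (α - 1) *
      (logDet (Q + t • (1 : Matrix (Fin d) (Fin d) ℂ)) - d * Real.log t) with hF
  have e : (fun t : ℝ => t ^ (α - 1) *
      logDetGap (X + t • (1 : Matrix (Fin d) (Fin d) ℂ)) (Y + t • 1)) =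
      fun t => F ((1 / 2 : ℝ) • (X + Y)) t - (1 / 2) * (F X t + F Y t) := by
    ext t
    have : (1 / 2 : ℝ) • (X + t • (1 : Matrix (Fin d) (Fin d) ℂ) + (Y + t • 1)) =
        (1 / 2 : ℝ) • (X + Y) + t • 1 := by module
    rw [logDetGap, this, hF]
    ring
  have iXY : IntegrableOn (fun t => (1 / 2) * (F X t + F Y t)) (Set.Ioi 0) :=
    (iX.add iY).const_mul _
  rw [e]
  refine ⟨iM.sub iXY, ?_⟩
  rw [integral_sub iM iXY, integral_const_mul, integral_add iX iY, eM, eX, eY, qjsdα,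
    tsallisEntropy_eq hM.1, tsallisEntropy_eq hX.1, tsallisEntropy_eq hY.1]
  have htr : ((1 / 2 : ℝ) • (X + Y)).trace.re = (1 / 2) * (X.trace.re + Y.trace.re) := by
    simp [trace_smul, trace_add]
    ring
  have : 1 - α ≠ 0 := by linarith
  rw [htr]
  field_simp
  ring

theorem qjsdα_pos {α : ℝ} (h0 : 0 < α) (h1 : α < 1) {X Y : Matrix (Fin d) (Fin d) ℂ}
    (hX : X.PosDef) (hY : Y.PosDef) (hXY : X ≠ Y) : 0 < qjsdα α X Y := by
  obtain ⟨hi, he⟩ := qjsdα_eq_integral h0 h1 hX hY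
  have hpos := setIntegral_Ioi_pos hi fun t ht => mul_pos (Real.rpow_pos_of_pos ht _)
    (logDetGap_pos (hX.add_real_smul_one ht) (hY.add_real_smul_one ht)
      fun h => hXY (add_right_cancel h))
  rw [he] at hpos
  exact pos_of_mul_pos_right hpos (mul_pos (rpowLogConst_pos h0 h1) (sub_pos.2 h1)).le

theorem qjsdα_self (α : ℝ) (X : Matrix (Fin d) (Fin d) ℂ) : qjsdα α X X = 0 := by
  have : (1 / 2 : ℝ) • (X + X) = X := by module
  rw [qjsdα, this]
  ring

theorem qjsdα_nonneg {α : ℝ} (h0 : 0 < α) (h1 : α < 1) {X Y : Matrix (Fin d) (Fin d) ℂ}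
    (hX : X.PosDef) (hY : Y.PosDef) : 0 ≤ qjsdα α X Y := by
  rcases eq_or_ne X Y with rfl | h
  · rw [qjsdα_self]
  · exact (qjsdα_pos h0 h1 hX hY h).le

theorem qjsdα_le {α : ℝ} (h0 : 0 < α) (h1 : α < 1) {X Y Z : Matrix (Fin d) (Fin d) ℂ}
    (hX : X.PosDef) (hY : Y.PosDef) (hZ : Z.PosDef) {lam : ℝ} (hl0 : 0 < lam) (hl1 : lam < 1) :
    qjsdα α X Z ≤ qjsdα α X Y / lam + qjsdα α Y Z / (1 - lam) := by
  obtain ⟨iXZ, eXZ⟩ := qjsdα_eq_integral h0 h1 hX hZ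
  obtain ⟨iXY, eXY⟩ := qjsdα_eq_integral h0 h1 hX hY
  obtain ⟨iYZ, eYZ⟩ := qjsdα_eq_integral h0 h1 hY hZ
  have hmono := setIntegral_mono_on iXZ ((iXY.div_const lam).add (iYZ.div_const (1 - lam)))
    measurableSet_Ioi fun t ht => by
      have ht0 : 0 < t := ht
      have := mul_le_mul_of_nonneg_left (logDetGap_le (hX.add_real_smul_one ht0)
        (hY.add_real_smul_one ht0) (hZ.add_real_smul_one ht0) hl0 hl1)
        (Real.rpow_nonneg ht0.le (α - 1))
      rwa [mul_add, mul_div_assoc', mul_div_assoc'] at this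
  simp only [Pi.add_apply] at hmono
  rw [integral_add (iXY.div_const lam) (iYZ.div_const (1 - lam)), integral_div, integral_div,
    eXZ, eXY, eYZ, mul_div_assoc, mul_div_assoc, ← mul_add] at hmono
  exact le_of_mul_le_mul_left hmono (mul_pos (rpowLogConst_pos h0 h1) (sub_pos.2 h1))

theorem qjsdα_comm (α : ℝ) (X Y : Matrix (Fin d) (Fin d) ℂ) : qjsdα α X Y = qjsdα α Y X := by
  rw [qjsdα, qjsdα, add_comm X Y, add_comm (tsallisEntropy α X)]

end

/-- For `α ∈ (0,1)`, `√(QJSD_α)` is a metric on `ℙ_d`. -/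
theorem qjsd_sqrt_metric_lt_one {d : ℕ} (α : ℝ) (hα : α ∈ Set.Ioo (0:ℝ) 1)
    (X Y Z : Matrix (Fin d) (Fin d) ℂ) (hX : X.PosDef) (hY : Y.PosDef) (hZ : Z.PosDef) :
    0 ≤ qjsdα α X Y ∧
    (qjsdα α X Y = 0 ↔ X = Y) ∧
    qjsdα α X Y = qjsdα α Y X ∧
    Real.sqrt (qjsdα α X Z) ≤ Real.sqrt (qjsdα α X Y) + Real.sqrt (qjsdα α Y Z) := by
  obtain ⟨h0, h1⟩ := hα
  refine ⟨qjsdα_nonneg h0 h1 hX hY, ⟨fun h => ?_, fun h => ?_⟩, qjsdα_comm α X Y, ?_⟩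
  · by_contra hne
    exact (qjsdα_pos h0 h1 hX hY hne).ne' h
  · rw [h, qjsdα_self]
  · exact sqrt_le_sqrt_add_sqrt_of_forall (qjsdα_nonneg h0 h1 hX hY) (qjsdα_nonneg h0 h1 hY hZ)
      fun lam hl0 hl1 => qjsdα_le h0 h1 hX hY hZ hl0 hl1
end
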